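/- arXiv:2102.01546 — 3 statements merged into one kernel-verified Lean document; each statement's English description precedes it below -/
import Mathlib

section
/- Let (Ω,Σ,μ) be a probability space, X a real Banach space, and ε ≥ 0. If M ⊆ X is ε-weakly precompact, then the set L(M) := {f ∈ L¹(μ,X) : f(ω) ∈ M for μ-a.e. ω ∈ Ω} is 2ε-weakly precompact in L¹(μ,X). -/
open Filter Topology MeasureTheory

/-- `δ((x_n)) ≤ ε`: for every functional in the closed unit ball of the dual,
`limsup x*(x_n) − liminf x*(x_n) ≤ ε`. -/
def DeltaLE {E : Type*} [NormedAddCommGroup E] [NormedSpace ℝ E] (x : ℕ → E) (ε : ℝ) : Prop :=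
  ∀ f : E →L[ℝ] ℝ, ‖f‖ ≤ 1 →
    Filter.limsup (fun n => f (x n)) Filter.atTop
      - Filter.liminf (fun n => f (x n)) Filter.atTop ≤ ε

/-- A set `M` is `ε`-weakly precompact if it is bounded and every sequence in `M`
admits a subsequence `(x_{n_k})` with `δ((x_{n_k})) ≤ ε`. -/
def IsWeaklyPrecompactWith {E : Type*} [NormedAddCommGroup E] [NormedSpace ℝ E]
    (ε : ℝ) (M : Set E) : Prop :=
  Bornology.IsBounded M ∧
    ∀ x : ℕ → E, (∀ n, x n ∈ M) →
      ∃ φ : ℕ → ℕ, StrictMono φ ∧ DeltaLE (fun k => x (φ k)) ε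


/-- Diagonal lemma for hereditary (mod finite) properties of infinite sets. -/
lemma wp_diag (P : ℕ → Set ℕ → Prop) (N0 : Set ℕ) (hN0 : N0.Infinite)
    (hered : ∀ j N N', P j N → (N' \ N).Finite → P j N')
    (hex : ∀ j N, N ⊆ N0 → N.Infinite → ∃ N' ⊆ N, N'.Infinite ∧ P j N') :
    ∃ N ⊆ N0, N.Infinite ∧ ∀ j, P j N := by
  classical
  choose! g hg1 hg2 hg3 using hex
  let S : ℕ → Set ℕ := fun k => Nat.rec N0 (fun j N => g j N) k
  have hS0 : S 0 = N0 := rfl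
  have hSs : ∀ k, S (k+1) = g k (S k) := fun k => rfl
  have hS : ∀ k, S k ⊆ N0 ∧ (S k).Infinite := by
    intro k
    induction k with
    | zero => exact ⟨le_rfl, hN0⟩
    | succ k ih => 
      rw [hSs]
      exact ⟨(hg1 k _ ih.1 ih.2).trans ih.1, hg2 k _ ih.1 ih.2⟩
  have hanti : Antitone S := antitone_nat_of_succ_le fun k => by
    rw [hSs]; exact hg1 k _ (hS k).1 (hS k).2
  have hpick : ∀ k m, ∃ n ∈ S k, m < n := fun k m => (hS k).2.exists_gt m
  choose e he1 he2 using hpick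
  let q : ℕ → ℕ := fun k => Nat.rec (e 0 0) (fun k r => e (k+1) r) k
  have hq : ∀ k, q k ∈ S k := by
    intro k
    cases k with
    | zero => exact he1 0 0
    | succ k => exact he1 (k+1) (q k)
  have hqm : StrictMono q := strictMono_nat_of_lt_succ fun k => he2 (k+1) (q k)
  refine ⟨Set.range q, ?_, Set.infinite_range_of_injective hqm.injective, ?_⟩
  · rintro _ ⟨k, rfl⟩; exact (hS k).1 (hq k)
  · intro j
    have hP : P j (S (j+1)) := by rw [hSs]; exact hg3 j _ (hS j).1 (hS j).2
    refine hered j _ _ hP ?_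
    refine (((Set.finite_Iic j).image q)).subset ?_
    rintro _ ⟨⟨k, rfl⟩, hk⟩
    refine ⟨k, ?_, rfl⟩
    by_contra hkj
    simp only [Set.mem_Iic, not_le] at hkj
    exact hk (hanti hkj (hq k))

/-- `N` converges on `Y` for the pairs `(A n true, A n false)`. -/
def WpConv {K : Type*} (A : ℕ → Bool → Set K) (N : Set ℕ) (Y : Set K) : Prop :=
  ∀ x ∈ Y, ∃ s, {n ∈ N | x ∈ A n s}.Finite

lemma WpConv.mono {K : Type*} {A : ℕ → Bool → Set K} {N N' : Set ℕ} {Y Y' : Set K}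
    (h : WpConv A N Y) (hN : (N' \ N).Finite) (hY : Y' ⊆ Y) : WpConv A N' Y' := by
  intro x hx
  obtain ⟨s, hs⟩ := h x (hY hx)
  refine ⟨s, (hs.union hN).subset ?_⟩
  rintro n ⟨h1, h2⟩
  by_cases hn : n ∈ N
  · exact Or.inl ⟨hn, h2⟩
  · exact Or.inr ⟨h1, hn⟩

def WpBad {K : Type*} (A : ℕ → Bool → Set K) (N : Set ℕ) (Y : Set K) : Prop :=
  ∀ N' ⊆ N, N'.Infinite → ¬ WpConv A N' Y

lemma wp_step {K : Type*} (A : ℕ → Bool → Set K) (C : Set (Set K)) (hC : C.Finite)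
    (N0 : Set ℕ) (hN0 : N0.Infinite) (hbad : ∀ Y ∈ C, WpBad A N0 Y) :
    ∃ j ∈ N0, ∃ N ⊆ N0, N.Infinite ∧ ∀ Y ∈ C, ∀ s, WpBad A N (Y ∩ A j s) := by
  by_contra hcon
  push Not at hcon
  let P : ℕ → Set ℕ → Prop := fun j N => j ∈ N0 → ∃ Y ∈ C, ∃ s, WpConv A N (Y ∩ A j s)
  obtain ⟨N, hN, hNi, hNP⟩ := wp_diag P N0 hN0
    (by
      rintro j N N' h hf hj
      obtain ⟨Y, hY, s, hs⟩ := h hj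
      exact ⟨Y, hY, s, hs.mono hf le_rfl⟩)
    (by
      intro j N hN hNi
      by_cases hj : j ∈ N0
      · obtain ⟨Y, hY, s, hs⟩ := hcon j hj N hN hNi
        simp only [WpBad, not_forall, not_not] at hs
        obtain ⟨N', h1, h2, h3⟩ := hs
        exact ⟨N', h1, h2, fun _ => ⟨Y, hY, s, h3⟩⟩
      · exact ⟨N, le_rfl, hNi, fun h => absurd h hj⟩)
  have hNP' : ∀ j ∈ N, ∃ p : Set K × Bool, p.1 ∈ C ∧ WpConv A N (p.1 ∩ A j p.2) := by
    intro j hj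
    obtain ⟨Y, hY, s, hs⟩ := hNP j (hN hj)
    exact ⟨(Y, s), hY, hs⟩
  choose! p hp1 hp2 using hNP'
  have hfin : (C ×ˢ (Set.univ : Set Bool)).Finite := hC.prod Set.finite_univ
  have hex : ∃ y ∈ C ×ˢ (Set.univ : Set Bool), {j ∈ N | p j = y}.Infinite := by
    by_contra hno
    push Not at hno
    apply hNi
    refine (hfin.biUnion hno).subset ?_
    intro j hj
    simp only [Set.mem_iUnion]
    exact ⟨p j, ⟨hp1 j hj, Set.mem_univ _⟩, hj, rfl⟩
  obtain ⟨⟨Y, s⟩, ⟨hY, -⟩, hyi⟩ := hex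
  refine hbad Y hY {j ∈ N | p j = (Y, s)} (fun j hj => hN hj.1) hyi ?_
  intro x hx
  by_cases h : ∃ j ∈ N, p j = (Y, s) ∧ x ∈ A j s
  · obtain ⟨j, hj, hpj, hxj⟩ := h
    have h2 := hp2 j hj
    rw [hpj] at h2
    obtain ⟨t, ht⟩ := h2 x ⟨hx, hxj⟩
    exact ⟨t, ht.subset fun n hn => ⟨hn.1.1, hn.2⟩⟩
  · refine ⟨s, ?_⟩
    convert Set.finite_empty
    ext n
    simp only [Set.mem_empty_iff_false, iff_false]
    exact fun hn => h ⟨n, hn.1.1, hn.1.2, hn.2⟩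

lemma wp_indep {K : Type*} (A : ℕ → Bool → Set K) (N0 : Set ℕ) (hN0 : N0.Infinite)
    (hbad : WpBad A N0 Set.univ) :
    ∃ q : ℕ → ℕ, StrictMono q ∧ ∀ (s : ℕ → Bool) k, ∃ x, ∀ i < k, x ∈ A (q i) (s i) := by
  let St := {p : Set (Set K) × Set ℕ // p.1.Finite ∧ p.2.Infinite ∧ ∀ Y ∈ p.1, WpBad A p.2 Y}
  have hstep : ∀ p : St, ∃ (j : ℕ) (p' : St), j ∈ p.1.2 ∧ p'.1.2 ⊆ p.1.2 ∧ (∀ m ∈ p'.1.2, j < m) ∧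
      ∀ Y ∈ p.1.1, ∀ s, Y ∩ A j s ∈ p'.1.1 := by
    rintro ⟨⟨C, N⟩, hC, hN, hb⟩
    obtain ⟨j, hj, N', h1, h2, h3⟩ := wp_step A C hC N hN hb
    refine ⟨j, ⟨⟨⋃ s : Bool, (fun Y => Y ∩ A j s) '' C, N' \ Set.Iic j⟩,
      Set.finite_iUnion fun s => hC.image _, h2.sdiff (Set.finite_Iic j), ?_⟩, hj, 
        Set.sdiff_subset.trans h1, ?_, ?_⟩
    · intro Y hY
      simp only [Set.mem_iUnion, Set.mem_image] at hY
      obtain ⟨s, Y, hY, rfl⟩ := hY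
      exact fun M hM => h3 Y hY s M (hM.trans Set.sdiff_subset)
    · intro m hm
      simpa using hm.2
    · intro Y hY s
      simp only [Set.mem_iUnion]
      exact ⟨s, Y, hY, rfl⟩
  choose j nx h1 h2 h3 h4 using hstep
  let p0 : St := ⟨⟨{Set.univ}, N0⟩, Set.finite_singleton _, hN0, by
    intro Y hY; rw [Set.mem_singleton_iff.1 hY]; exact hbad⟩
  let p : ℕ → St := fun k => nx^[k] p0
  have hps : ∀ k, p (k+1) = nx (p k) := fun k => Function.iterate_succ_apply' _ _ _
  refine ⟨fun k => j (p k), strictMono_nat_of_lt_succ fun k => ?_, ?_⟩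
  · apply h3 (p k)
    rw [← hps]; exact h1 _
  · intro s k
    have hmem : ∀ k, {x | ∀ i < k, x ∈ A (j (p i)) (s i)} ∈ (p k).1.1 := by
      intro k
      induction k with
      | zero => simp [p, p0]
      | succ k ih =>
        rw [hps]
        have := h4 (p k) _ ih (s k)
        convert this using 1
        ext x
        simp only [Set.mem_ofPred_eq, Set.mem_inter_iff, Nat.lt_succ_iff_lt_or_eq]
        constructor
        · exact fun h => ⟨fun i hi => h i (Or.inl hi), h k (Or.inr rfl)⟩
        · rintro ⟨ha, hb⟩ i (hi | rfl)
          · exact ha i hi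
          · exact hb
    have hb := (p k).2.2.2 _ (hmem k) _ le_rfl (p k).2.2.1
    by_contra hcon
    push Not at hcon
    apply hb
    intro x hx
    obtain ⟨i, hi, hxi⟩ := hcon x
    exact absurd (hx i hi) hxi
lemma wp_isBdd {u : ℕ → ℝ} {R : ℝ} (hu : ∀ n, |u n| ≤ R) :
    IsBoundedUnder (· ≤ ·) atTop u ∧ IsBoundedUnder (· ≥ ·) atTop u :=
  ⟨isBoundedUnder_of ⟨R, fun n => (abs_le.1 (hu n)).2⟩,
    isBoundedUnder_of ⟨-R, fun n => (abs_le.1 (hu n)).1⟩⟩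

lemma wp_gap {u : ℕ → ℝ} {R ε : ℝ} (hu : ∀ n, |u n| ≤ R)
    (h : ε < limsup u atTop - liminf u atTop) :
    ∃ a b : ℚ, ε < (b : ℝ) - a ∧ (∃ᶠ n in atTop, u n < a) ∧ (∃ᶠ n in atTop, (b : ℝ) < u n) := by
  obtain ⟨hb1, hb2⟩ := wp_isBdd hu
  set t := (limsup u atTop - liminf u atTop - ε) / 2 with ht
  have ht0 : 0 < t := by rw [ht]; linarith
  obtain ⟨b, hb, hb'⟩ := exists_rat_btwn (show limsup u atTop - t < limsup u atTop by linarith)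
  obtain ⟨a, ha, ha'⟩ := exists_rat_btwn (show liminf u atTop < liminf u atTop + t by linarith)
  refine ⟨a, b, by linarith, ?_, ?_⟩
  · exact frequently_lt_of_liminf_lt hb1.isCoboundedUnder_ge ha
  · exact frequently_lt_of_lt_limsup hb2.isCoboundedUnder_le hb'

lemma wp_mid {u : ℕ → ℝ} {R ε : ℝ} (hu : ∀ n, |u n| ≤ R)
    (h : limsup u atTop - liminf u atTop ≤ ε) :
    Tendsto (fun n => max (|u n - (limsup u atTop + liminf u atTop) / 2| - ε / 2) 0) atTop (𝓝 0) := by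
  obtain ⟨hb1, hb2⟩ := wp_isBdd hu
  rw [Metric.tendsto_atTop']
  intro t ht
  have h1 := eventually_lt_of_limsup_lt (show limsup u atTop < limsup u atTop + t / 2 by linarith) hb1
  have h2 := eventually_lt_of_lt_liminf (show liminf u atTop - t / 2 < liminf u atTop by linarith) hb2
  obtain ⟨N, hN⟩ := eventually_atTop.1 (h1.and h2)
  refine ⟨N, fun n hn => ?_⟩
  obtain ⟨h3, h4⟩ := hN n hn.le
  rw [Real.dist_eq, sub_zero, abs_of_nonneg (le_max_right _ _)]
  refine max_lt ?_ ht
  have : |u n - (limsup u atTop + liminf u atTop) / 2| < ε / 2 + t := by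
    rw [abs_lt]; constructor <;> linarith
  linarith

lemma wp_limsup_abs {u : ℕ → ℝ} {R : ℝ} (hu : ∀ n, |u n| ≤ R) :
    |limsup u atTop| ≤ R ∧ |liminf u atTop| ≤ R := by
  obtain ⟨hb1, hb2⟩ := wp_isBdd hu
  refine ⟨abs_le.2 ⟨?_, ?_⟩, abs_le.2 ⟨?_, ?_⟩⟩
  · exact le_limsup_of_frequently_le (Frequently.of_forall fun n => (abs_le.1 (hu n)).1) hb1
  · exact limsup_le_of_le hb2.isCoboundedUnder_le (Eventually.of_forall fun n => (abs_le.1 (hu n)).2)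
  · exact le_liminf_of_le hb1.isCoboundedUnder_ge (Eventually.of_forall fun n => (abs_le.1 (hu n)).1)
  · exact liminf_le_of_frequently_le (Frequently.of_forall fun n => (abs_le.1 (hu n)).2) hb2

/-- Quantitative Rosenthal dichotomy. -/
lemma wp_rosenthal {K : Type*} (φ : ℕ → K → ℝ) {R ε : ℝ} (hR : ∀ n x, |φ n x| ≤ R)
    (h : ∀ θ : ℕ → ℕ, StrictMono θ → ∃ x, ε < limsup (fun n => φ (θ n) x) atTop -
      liminf (fun n => φ (θ n) x) atTop) :
    ∃ (a b : ℝ) (q : ℕ → ℕ), ε < b - a ∧ StrictMono q ∧ ∀ (s : ℕ → Bool) k, ∃ x, ∀ i < k,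
      (s i = true → b < φ (q i) x) ∧ (s i = false → φ (q i) x < a) := by
  let A : ℚ × ℚ → ℕ → Bool → Set K := fun p n s =>
    {x | (s = true → (p.2 : ℝ) < φ n x) ∧ (s = false → φ n x < (p.1 : ℝ))}
  by_contra hcon
  have key : ∀ p : ℚ × ℚ, ε < (p.2 : ℝ) - p.1 → ∀ N : Set ℕ, N.Infinite →
      ∃ N' ⊆ N, N'.Infinite ∧ WpConv (A p) N' Set.univ := by
    intro p hp N hN
    by_contra hno
    apply hcon
    obtain ⟨q, hq, hq2⟩ := wp_indep (A p) N hN (by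
      intro N' h1 h2 h3
      exact hno ⟨N', h1, h2, h3⟩)
    exact ⟨p.1, p.2, q, hp, hq, hq2⟩
  let P : ℕ → Set ℕ → Prop := fun j N => ∀ p : ℚ × ℚ, Encodable.encode p = j →
    ε < (p.2 : ℝ) - p.1 → WpConv (A p) N Set.univ
  obtain ⟨N, -, hN, hNP⟩ := wp_diag P Set.univ Set.infinite_univ
    (by
      intro j N N' h1 h2 p hp hpe
      exact (h1 p hp hpe).mono h2 le_rfl)
    (by
      intro j N _ hN
      by_cases hj : ∃ p : ℚ × ℚ, Encodable.encode p = j ∧ ε < (p.2 : ℝ) - p.1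
      · obtain ⟨p, hp, hpe⟩ := hj
        obtain ⟨N', h1, h2, h3⟩ := key p hpe N hN
        refine ⟨N', h1, h2, fun p' hp' _ => ?_⟩
        have : p' = p := Encodable.encode_injective (hp'.trans hp.symm)
        rw [this]; exact h3
      · exact ⟨N, le_rfl, hN, fun p hp hpe => absurd ⟨p, hp, hpe⟩ hj⟩)
  obtain ⟨x, hx⟩ := h (Nat.nth (· ∈ N)) (Nat.nth_strictMono hN)
  obtain ⟨a, b, hab, hfa, hfb⟩ := wp_gap (fun n => hR _ x) hx
  obtain ⟨s, hs⟩ := hNP _ (a, b) rfl hab x (Set.mem_univ _)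
  have hθ : ∀ n, Nat.nth (· ∈ N) n ∈ N := fun n => Nat.nth_mem_of_infinite hN n
  have hpre := hs.preimage (f := Nat.nth (· ∈ N)) (Nat.nth_injective hN).injOn
  cases s with
  | true =>
    rw [Nat.frequently_atTop_iff_infinite] at hfb
    refine hfb (hpre.subset ?_)
    intro n hn
    exact ⟨hθ n, fun _ => hn, fun h => by simp at h⟩
  | false =>
    rw [Nat.frequently_atTop_iff_infinite] at hfa
    refine hfa (hpre.subset ?_)
    intro n hn
    exact ⟨hθ n, fun h => by simp at h, fun _ => hn⟩
lemma wp_sign_sum (k : ℕ) (i j : Fin k) (hij : i ≠ j) :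
    ∑ s : Fin k → Bool, (if s i then (1 : ℝ) else -1) * (if s j then (1 : ℝ) else -1) = 0 := by
  classical
  refine Finset.sum_involution (fun s _ => Function.update s i (!s i)) ?_ ?_ ?_ ?_
  · intro s _
    have : Function.update s i (!s i) j = s j := Function.update_of_ne hij.symm _ _
    rw [this, Function.update_self]
    cases s i <;> cases s j <;> simp
  · intro s _ _ h
    have := congrFun h i
    simp at this
  · simp
  · intro s _
    simp

lemma wp_measure {K : Type*} [TopologicalSpace K] [CompactSpace K] [T2Space K]
    [MeasurableSpace K] [BorelSpace K] (φ : ℕ → K → ℝ) (hφ : ∀ n, Continuous (φ n)) (a b : ℝ)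
    (hab : a < b)
    (hind : ∀ (s : ℕ → Bool) k, ∃ x, ∀ i < k,
      (s i = true → b < φ i x) ∧ (s i = false → φ i x < a)) :
    ∃ (ν : Measure K) (ψ : ℕ → K → ℝ), IsProbabilityMeasure ν ∧ (∀ n, Continuous (ψ n)) ∧
      (∀ n x, |ψ n x| ≤ 1) ∧ (∀ n m, ∫ x, ψ n x * ψ m x ∂ν = if n = m then 1 else 0) ∧
      ∀ n, (b - a) / 2 ≤ ∫ x, ψ n x * (φ n x - (a + b) / 2) ∂ν := by
  classical
  let ψ : ℕ → K → ℝ := fun n x => max (-1) (min 1 ((φ n x - (a + b) / 2) / ((b - a) / 2)))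
  have hc : 0 < (b - a) / 2 := by linarith
  have hψc : ∀ n, Continuous (ψ n) := fun n => by
    have := hφ n
    fun_prop
  have hψ1 : ∀ n x, |ψ n x| ≤ 1 := fun n x => abs_le.2
    ⟨le_max_left _ _, max_le (by norm_num) (min_le_left _ _)⟩
  have hψt : ∀ n x, b < φ n x → ψ n x = 1 := fun n x h => by
    have : 1 ≤ (φ n x - (a + b) / 2) / ((b - a) / 2) := by
      rw [le_div_iff₀ hc]; linarith
    simp [ψ, min_eq_left this]
  have hψf : ∀ n x, φ n x < a → ψ n x = -1 := fun n x h => by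
    have : (φ n x - (a + b) / 2) / ((b - a) / 2) ≤ -1 := by
      rw [div_le_iff₀ hc]; linarith
    simp only [ψ]
    rw [min_eq_right (by linarith), max_eq_left this]
  have hpt : ∀ k, ∀ s : Fin k → Bool, ∃ x, ∀ i : Fin k,
      (s i = true → b < φ i x) ∧ (s i = false → φ i x < a) := by
    intro k s
    obtain ⟨x, hx⟩ := hind (fun n => if h : n < k then s ⟨n, h⟩ else true) k
    refine ⟨x, fun i => ?_⟩
    have := hx i i.2
    simpa using this
  choose p hp using hpt
  have hpψ : ∀ k (s : Fin k → Bool) (i : Fin k), ψ i (p k s) = if s i then 1 else -1 := by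
    intro k s i
    cases h : s i with
    | true => simpa using hψt _ _ ((hp k s i).1 h)
    | false => simpa using hψf _ _ ((hp k s i).2 h)
  let ν0 : ∀ k, Measure K := fun k => (PMF.uniformOfFintype (Fin k → Bool)).toMeasure.map (p k)
  have hpm : ∀ k, Measurable (p k) := fun k => measurable_of_countable _
  have hν0 : ∀ k, IsProbabilityMeasure (ν0 k) := fun k =>
    Measure.isProbabilityMeasure_map (hpm k).aemeasurable
  have hint : ∀ k (F : K → ℝ), Continuous F →
      ∫ x, F x ∂(ν0 k) = ∑ s, ((2 : ℝ) ^ k)⁻¹ * F (p k s) := by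
    intro k F hF
    rw [integral_map (hpm k).aemeasurable hF.measurable.aestronglyMeasurable, PMF.integral_eq_sum]
    refine Finset.sum_congr rfl fun s _ => ?_
    simp
  have hconst : ∀ k, ∑ s : Fin k → Bool, ((2 : ℝ) ^ k)⁻¹ = 1 := by
    intro k
    simp
  let νP : ℕ → ProbabilityMeasure K := fun k => ⟨ν0 k, hν0 k⟩
  obtain ⟨ν, -, hν⟩ := (isCompact_univ (X := ProbabilityMeasure K)).ultrafilter_le_nhds
    ((hyperfilter ℕ).map νP) (by simp)
  have hνt : Tendsto νP (hyperfilter ℕ) (𝓝 ν) := hν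
  have hlim : ∀ F : K → ℝ, Continuous F →
      Tendsto (fun k => ∫ x, F x ∂(ν0 k)) (hyperfilter ℕ) (𝓝 (∫ x, F x ∂(ν : Measure K))) := by
    intro F hF
    exact ((ProbabilityMeasure.continuous_integral_continuousMap
      (⟨F, hF⟩ : C(K, ℝ))).tendsto ν).comp hνt
  have hev : ∀ n : ℕ, ∀ᶠ k in (hyperfilter ℕ : Filter ℕ), n < k := fun n => by
    have : (hyperfilter ℕ : Filter ℕ) ≤ atTop := by
      rw [← Nat.cofinite_eq_atTop]; exact hyperfilter_le_cofinite
    exact this (eventually_gt_atTop n)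
  refine ⟨ν, ψ, inferInstance, hψc, hψ1, ?_, ?_⟩
  · intro n m
    have hFc : Continuous fun x => ψ n x * ψ m x := (hψc n).mul (hψc m)
    refine tendsto_nhds_unique (hlim _ hFc) ?_
    refine tendsto_const_nhds.congr' ?_
    filter_upwards [hev n, hev m] with k hn hm
    rw [hint k _ hFc, ← Finset.mul_sum]
    have : ∀ s, ψ n (p k s) * ψ m (p k s) =
        (if s ⟨n, hn⟩ then (1 : ℝ) else -1) * (if s ⟨m, hm⟩ then (1 : ℝ) else -1) := by
      intro s
      rw [← hpψ, ← hpψ]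
    simp_rw [this]
    by_cases hnm : n = m
    · subst hnm
      rw [if_pos rfl]
      have : ∀ s : Fin k → Bool, (if s ⟨n, hn⟩ then (1 : ℝ) else -1) *
        (if s ⟨n, hn⟩ then (1 : ℝ) else -1) = 1 := by
        intro s; split_ifs <;> norm_num
      simp_rw [this]
      simp
    · rw [if_neg hnm, wp_sign_sum k _ _ (by simpa using hnm), mul_zero]
  · intro n
    have hFc : Continuous fun x => ψ n x * (φ n x - (a + b) / 2) := by
      have := hφ n
      have := hψc n
      fun_prop
    refine ge_of_tendsto (hlim _ hFc) ?_
    filter_upwards [hev n] with k hn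
    rw [hint k _ hFc]
    calc (b - a) / 2 = ∑ s : Fin k → Bool, ((2 : ℝ) ^ k)⁻¹ * ((b - a) / 2) := by
          rw [← Finset.sum_mul, hconst, one_mul]
      _ ≤ _ := by
          refine Finset.sum_le_sum fun s _ => ?_
          refine mul_le_mul_of_nonneg_left ?_ (by positivity)
          have h1 := hpψ k s ⟨n, hn⟩
          have h2 := hp k s ⟨n, hn⟩
          simp only at h1 h2
          cases h : s ⟨n, hn⟩ with
          | true => 
            rw [h] at h1
            have := h2.1 h
            simp only [if_true] at h1
            rw [h1]; linarith
          | false => 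
            rw [h] at h1
            have := h2.2 h
            simp only [Bool.false_eq_true, if_false] at h1
            rw [h1]; linarith

/-- Bessel: orthonormal bounded functions are weakly null. -/
lemma wp_weaknull {K : Type*} [MeasurableSpace K] (ν : Measure K) [IsProbabilityMeasure ν]
    (ψ : ℕ → K → ℝ) (hm : ∀ n, Measurable (ψ n)) (hψ1 : ∀ n x, |ψ n x| ≤ 1)
    (horth : ∀ n m, ∫ x, ψ n x * ψ m x ∂ν = if n = m then 1 else 0)
    (g : K → ℝ) (hg : Measurable g) (R : ℝ) (hgR : ∀ x, |g x| ≤ R) :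
    Tendsto (fun n => ∫ x, ψ n x * g x ∂ν) atTop (𝓝 0) := by
  have hmem : ∀ n, MemLp (ψ n) 2 ν := fun n =>
    MemLp.of_bound (hm n).aestronglyMeasurable 1 (ae_of_all _ fun x => hψ1 n x)
  have hgm : MemLp g 2 ν := MemLp.of_bound hg.aestronglyMeasurable R (ae_of_all _ fun x => hgR x)
  have hinner : ∀ u v : K → ℝ, ∀ (hu : MemLp u 2 ν) (hv : MemLp v 2 ν),
      inner ℝ (hu.toLp u) (hv.toLp v) = ∫ x, u x * v x ∂ν := by
    intro u v hu hv
    rw [L2.inner_def]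
    refine integral_congr_ae ?_
    filter_upwards [hu.coeFn_toLp, hv.coeFn_toLp] with x h1 h2
    rw [h1, h2]
    simp [mul_comm]
  have hon : Orthonormal ℝ (fun n => (hmem n).toLp (ψ n)) := by
    rw [orthonormal_iff_ite]
    intro i j
    rw [hinner, horth]
  have hs := (hon.inner_products_summable ((hgm.toLp g))).tendsto_atTop_zero
  simp_rw [hinner] at hs
  have h2 := hs.sqrt
  simp only [Real.sqrt_sq (norm_nonneg _), Real.sqrt_zero] at h2
  exact tendsto_zero_iff_norm_tendsto_zero.2 h2
lemma wp_density {Ω X : Type*} [MeasurableSpace Ω] [NormedAddCommGroup X] [NormedSpace ℝ X]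
    (μ : Measure Ω) [IsProbabilityMeasure μ] (Λ : Lp X 1 μ →L[ℝ] ℝ) (x : X) :
    ∃ g : Ω → ℝ, Integrable g μ ∧ ∀ A (hA : MeasurableSet A),
      Λ (indicatorConstLp 1 hA (measure_ne_top μ A) x) = ∫ ω in A, g ω ∂μ := by
  let incl : Lp ℝ 2 μ →L[ℝ] Lp ℝ 1 μ := LinearMap.mkContinuous
    { toFun := fun u => ⟨u.1, Lp.antitone (by norm_num) u.2⟩
      map_add' := fun _ _ => rfl
      map_smul' := fun _ _ => rfl } 1 (by
    intro u
    rw [one_mul, Lp.norm_def, Lp.norm_def]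
    refine ENNReal.toReal_mono (Lp.eLpNorm_ne_top u) ?_
    exact eLpNorm_le_eLpNorm_of_exponent_le (by norm_num) (Lp.aestronglyMeasurable u))
  let T : Lp ℝ 2 μ →L[ℝ] ℝ := Λ ∘L
    (ContinuousLinearMap.compLpL 1 μ (ContinuousLinearMap.toSpanSingleton ℝ x)) ∘L incl
  let G : Lp ℝ 2 μ := (InnerProductSpace.toDual ℝ (Lp ℝ 2 μ)).symm T
  refine ⟨G, (Lp.memLp G).integrable (by norm_num), fun A hA => ?_⟩
  have h1 : T (indicatorConstLp 2 hA (measure_ne_top μ A) 1) = ∫ ω in A, G ω ∂μ := by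
    rw [← InnerProductSpace.toDual_symm_apply (𝕜 := ℝ) (y := T), real_inner_comm,
      L2.inner_indicatorConstLp_one]
  rw [← h1]
  change _ = Λ _
  congr 1
  apply Lp.ext
  refine indicatorConstLp_coeFn.trans ?_
  refine EventuallyEq.trans ?_ (ContinuousLinearMap.coeFn_compLpL _ _).symm
  change _ =ᵐ[μ] fun a => ContinuousLinearMap.toSpanSingleton ℝ x
    ((indicatorConstLp 2 hA (measure_ne_top μ A) (1 : ℝ) : Lp ℝ 2 μ) a)
  filter_upwards [indicatorConstLp_coeFn (p := 2) (hs := hA) (hμs := measure_ne_top μ A)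
    (c := (1 : ℝ))] with ω hω
  rw [hω]
  by_cases h : ω ∈ A <;> simp [h]

/-- The functional `x ↦ Λ(1_A x) / μ(A)`. -/
lemma wp_avg {Ω X : Type*} [MeasurableSpace Ω] [NormedAddCommGroup X] [NormedSpace ℝ X]
    (μ : Measure Ω) [IsProbabilityMeasure μ] (Λ : Lp X 1 μ →L[ℝ] ℝ) (hΛ : ‖Λ‖ ≤ 1)
    (A : Set Ω) (hA : MeasurableSet A) :
    ∃ ξ : X →L[ℝ] ℝ, ‖ξ‖ ≤ 1 ∧
      ∀ x, ξ x = Λ (indicatorConstLp 1 hA (measure_ne_top μ A) x) / μ.real A := by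
  have hsm : ∀ (c : ℝ) (x : X), indicatorConstLp 1 hA (measure_ne_top μ A) (c • x) =
      c • indicatorConstLp 1 hA (measure_ne_top μ A) x := by
    intro c x
    apply Lp.ext
    refine indicatorConstLp_coeFn.trans ?_
    refine EventuallyEq.trans ?_ (Lp.coeFn_smul _ _).symm
    filter_upwards [indicatorConstLp_coeFn (p := 1) (hs := hA) (hμs := measure_ne_top μ A)
      (c := x)] with ω hω
    rw [Pi.smul_apply, hω]
    by_cases h : ω ∈ A <;> simp [h]
  let ξ : X →ₗ[ℝ] ℝ :=
    { toFun := fun x => Λ (indicatorConstLp 1 hA (measure_ne_top μ A) x) / μ.real A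
      map_add' := fun x y => by rw [← indicatorConstLp_add, map_add, add_div]
      map_smul' := fun c x => by
        rw [hsm, map_smul, smul_eq_mul, mul_div_assoc]; rfl }
  have hb : ∀ x, ‖ξ x‖ ≤ 1 * ‖x‖ := by
    intro x
    change ‖Λ (indicatorConstLp 1 hA (measure_ne_top μ A) x) / μ.real A‖ ≤ _
    rw [norm_div, Real.norm_of_nonneg (measureReal_nonneg (μ := μ) (s := A)), one_mul]
    refine div_le_of_le_mul₀ measureReal_nonneg (norm_nonneg _) ?_
    refine (Λ.le_of_opNorm_le hΛ _).trans ?_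
    rw [one_mul, norm_indicatorConstLp (by norm_num) (by norm_num)]
    simp
  exact ⟨ξ.mkContinuous 1 hb, ξ.mkContinuous_norm_le zero_le_one hb, fun x => rfl⟩

/-- Pointwise limits of functionals in the unit ball extend to functionals in the unit ball. -/
lemma wp_extend {X : Type*} [NormedAddCommGroup X] [NormedSpace ℝ X] (ξ : ℕ → X →L[ℝ] ℝ)
    (hξ : ∀ k, ‖ξ k‖ ≤ 1) (d : ℕ → X) (h : ℕ → ℝ)
    (hlim : ∀ j, Tendsto (fun k => ξ k (d j)) atTop (𝓝 (h j))) :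
    ∃ η : X →L[ℝ] ℝ, ‖η‖ ≤ 1 ∧ ∀ j, η (d j) = h j := by
  have hc := WeakDual.isCompact_closedBall (𝕜 := ℝ) (E := X) 0 1
  let ζ : ℕ → WeakDual ℝ X := fun k => StrongDual.toWeakDual (ξ k)
  obtain ⟨η, hη, hle⟩ := hc.ultrafilter_le_nhds ((hyperfilter ℕ).map ζ) (by
    rw [le_principal_iff]
    refine Filter.mem_map.2 (Filter.univ_mem' fun k => ?_)
    simpa [ζ] using hξ k)
  have ht : Tendsto ζ (hyperfilter ℕ) (𝓝 η) := hle
  refine ⟨WeakDual.toStrongDual η, by simpa using hη, fun j => ?_⟩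
  have h1 : Tendsto (fun k => ζ k (d j)) (hyperfilter ℕ) (𝓝 (η (d j))) :=
    ((WeakDual.eval_continuous (d j)).tendsto η).comp ht
  have hle' : (hyperfilter ℕ : Filter ℕ) ≤ atTop := by
    rw [← Nat.cofinite_eq_atTop]; exact hyperfilter_le_cofinite
  exact tendsto_nhds_unique h1 ((hlim j).mono_left hle')
/-- The atoms of the partition generated by the first `k` index functions. -/
def wpAtom {Ω : Type*} (i : ℕ → Ω → ℕ) (k : ℕ) (v : Fin k → ℕ) : Set Ω :=
  (fun ω => fun n : Fin k => i n ω) ⁻¹' {v}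

lemma wpAtom_meas {Ω : Type*} [MeasurableSpace Ω] {i : ℕ → Ω → ℕ} (hi : ∀ n, Measurable (i n))
    (k : ℕ) (v : Fin k → ℕ) : MeasurableSet (wpAtom i k v) := by
  have : Measurable (fun ω => fun n : Fin k => i n ω) := measurable_pi_lambda _ fun n => hi n
  exact this (measurableSet_singleton v)

lemma wp_conv {Ω X : Type*} [MeasurableSpace Ω] [NormedAddCommGroup X] [NormedSpace ℝ X]
    (μ : Measure Ω) [IsProbabilityMeasure μ] {i : ℕ → Ω → ℕ} (hi : ∀ n, Measurable (i n))
    (Λ : Lp X 1 μ →L[ℝ] ℝ) (x : X) :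
    ∃ g : Ω → ℝ, Integrable g μ ∧
      (∀ᵐ ω ∂μ, Tendsto (fun k => Λ (indicatorConstLp 1 (wpAtom_meas hi k (fun n => i n ω))
        (measure_ne_top μ _) x) / μ.real (wpAtom i k (fun n => i n ω))) atTop (𝓝 (g ω))) ∧
      ∀ n j, Λ (indicatorConstLp 1 (hi n (measurableSet_singleton j)) (measure_ne_top μ _) x) =
        ∫ ω in i n ⁻¹' {j}, g ω ∂μ := by
  obtain ⟨g, hg, hgA⟩ := wp_density μ Λ x
  let code : ∀ k, Ω → (Fin k → ℕ) := fun k ω n => i n ω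
  have hcode : ∀ k, Measurable (code k) := fun k => measurable_pi_lambda _ fun n => hi n
  let ℱ : Filtration ℕ (inferInstance : MeasurableSpace Ω) :=
    { seq := fun k => MeasurableSpace.comap (code k) inferInstance
      mono' := by
        intro k l hkl
        have h1 : code k = (fun v : Fin l → ℕ => fun n : Fin k => v (Fin.castLE hkl n)) ∘ code l := rfl
        have h2 : Measurable (fun v : Fin l → ℕ => fun n : Fin k => v (Fin.castLE hkl n)) := by
          fun_prop
        change MeasurableSpace.comap (code k) _ ≤ MeasurableSpace.comap (code l) _
        rw [h1, ← MeasurableSpace.comap_comp]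
        exact MeasurableSpace.comap_mono h2.comap_le
      le' := fun k => (hcode k).comap_le }
  have hle : (⨆ k, ℱ k) ≤ (inferInstance : MeasurableSpace Ω) := iSup_le fun k => ℱ.le k
  refine ⟨μ[g|⨆ k, ℱ k], integrable_condExp, ?_, ?_⟩
  · have hE : ∀ k, ∀ᵐ ω ∂μ, (μ[g|ℱ k]) ω = Λ (indicatorConstLp 1
        (wpAtom_meas hi k (fun n => i n ω)) (measure_ne_top μ _) x) /
          μ.real (wpAtom i k (fun n => i n ω)) := by
      intro k
      have hpos : ∀ᵐ ω ∂μ, ∀ v : Fin k → ℕ, ω ∈ wpAtom i k v → μ (wpAtom i k v) ≠ 0 := by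
        rw [ae_all_iff]
        intro v
        by_cases hv : μ (wpAtom i k v) = 0
        · filter_upwards [measure_eq_zero_iff_ae_notMem.1 hv] with ω hω h
          exact absurd h hω
        · exact ae_of_all _ fun _ _ => hv
      filter_upwards [hpos] with ω hω
      have hne := hω (fun n => i n ω) rfl
      set A := wpAtom i k (fun n => i n ω) with hA
      have hAm : MeasurableSet[ℱ k] A := ⟨{code k ω}, measurableSet_singleton _, rfl⟩
      rw [hgA, ← setIntegral_condExp (ℱ.le k) hg hAm]
      have hconst : ∀ ω' ∈ A, (μ[g|ℱ k]) ω' = (μ[g|ℱ k]) ω := by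
        intro ω' hω'
        have hm : MeasurableSet[ℱ k] ((μ[g|ℱ k]) ⁻¹' {(μ[g|ℱ k]) ω}) :=
          (stronglyMeasurable_condExp (m := ℱ k) (μ := μ) (f := g)).measurable
            (measurableSet_singleton _)
        obtain ⟨S, -, hS⟩ := hm
        have h1 : ω ∈ code k ⁻¹' S := by rw [hS]; rfl
        have h2 : code k ω' = code k ω := hω'
        have h3 : ω' ∈ code k ⁻¹' S := by
          change code k ω' ∈ S; rw [h2]; exact h1
        rw [hS] at h3
        exact h3
      rw [setIntegral_congr_fun (ℱ.le k _ hAm) hconst, setIntegral_const, smul_eq_mul,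
        mul_div_cancel_left₀]
      exact (measureReal_ne_zero_iff (measure_ne_top μ _)).2 hne
    filter_upwards [ae_all_iff.2 hE, tendsto_ae_condExp (μ := μ) (ℱ := ℱ) g] with ω h1 h2
    exact h2.congr h1
  · intro n j
    rw [hgA]
    have hm : MeasurableSet[⨆ k, ℱ k] (i n ⁻¹' {j}) := by
      refine le_iSup (fun k => (ℱ k : MeasurableSpace Ω)) (n+1) _ ?_
      exact ⟨(fun v : Fin (n+1) → ℕ => v (Fin.last n)) ⁻¹' {j},
        (measurable_pi_apply (Fin.last n)) (measurableSet_singleton j), rfl⟩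
    rw [setIntegral_condExp hle hg hm]
lemma wp_point {K X : Type*} [MeasurableSpace K] [NormedAddCommGroup X] [NormedSpace ℝ X]
    (ν : Measure K) [IsProbabilityMeasure ν]
    (ψ : ℕ → K → ℝ) (hm : ∀ n, Measurable (ψ n)) (hψ1 : ∀ n x, |ψ n x| ≤ 1)
    (horth : ∀ n m, ∫ x, ψ n x * ψ m x ∂ν = if n = m then 1 else 0)
    {ε : ℝ} {M : Set X} (hM : IsWeaklyPrecompactWith ε M) (d : ℕ → X) (hd : ∀ j, d j ∈ M) (R : ℝ)
    (h : ℕ → K → ℝ) (hh : ∀ j, Measurable (h j)) (hR : ∀ j x, |h j x| ≤ R)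
    (hext : ∀ᵐ x ∂ν, ∃ η : X →L[ℝ] ℝ, ‖η‖ ≤ 1 ∧ ∀ j, η (d j) = h j x)
    (idx : ℕ → ℕ) (t : ℝ) (ht : 0 < t) :
    ∀ᶠ n in atTop, ∫ x, ψ n x * h (idx n) x ∂ν ≤ ε / 2 + t := by
  by_contra hcon
  rw [not_eventually] at hcon
  obtain ⟨θ, hθ, hθ2⟩ := extraction_of_frequently_atTop hcon
  obtain ⟨τ, hτ, hδ⟩ := hM.2 (fun n => d (idx (θ n))) (fun n => hd _)
  have hmono : StrictMono (fun n => θ (τ n)) := hθ.comp hτ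
  let u : ℕ → K → ℝ := fun n => h (idx (θ (τ n)))
  let m : K → ℝ := fun x =>
    (limsup (fun n => u n x) atTop + liminf (fun n => u n x) atTop) / 2
  have hum : ∀ n, Measurable (u n) := fun n => hh _
  have hmm : Measurable m := ((Measurable.limsup hum).add (Measurable.liminf hum)).div_const 2
  have huR : ∀ x n, |u n x| ≤ R := fun x n => hR _ x
  have hmR : ∀ x, |m x| ≤ R := by
    intro x
    obtain ⟨h1, h2⟩ := wp_limsup_abs (huR x)
    rw [abs_le] at h1 h2 ⊢
    constructor <;> simp only [m] <;> linarith [h1.1, h1.2, h2.1, h2.2]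
  let w : ℕ → K → ℝ := fun n x => max (|u n x - m x| - ε / 2) 0
  have hwm : ∀ n, Measurable (w n) := fun n =>
    ((((hum n).sub hmm).abs).sub_const _).max measurable_const
  have hwt : ∀ᵐ x ∂ν, Tendsto (fun n => w n x) atTop (𝓝 0) := by
    filter_upwards [hext] with x ⟨η, hη, hηd⟩
    have := hδ η hη
    simp only [hηd] at this
    exact wp_mid (huR x) this
  have hR0 : 0 ≤ R := by
    obtain ⟨x⟩ := ν.nonempty_of_neZero
    exact (abs_nonneg _).trans (huR x 0)
  have hwR : ∀ n x, ‖w n x‖ ≤ 2 * R + |ε / 2| := by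
    intro n x
    rw [Real.norm_of_nonneg (le_max_right _ _)]
    refine max_le ?_ (by positivity)
    have h1 := abs_sub (u n x) (m x)
    have h2 := huR x n
    have h3 := hmR x
    have h4 := neg_abs_le (ε / 2)
    linarith
  have hwi : Tendsto (fun n => ∫ x, w n x ∂ν) atTop (𝓝 0) := by
    have := tendsto_integral_of_dominated_convergence (μ := ν) (F := w) (f := fun _ => (0 : ℝ))
      (fun _ => 2 * R + |ε / 2|) (fun n => (hwm n).aestronglyMeasurable) (integrable_const _)
      (fun n => ae_of_all _ (hwR n)) hwt
    simpa using this
  have hnull := (wp_weaknull ν ψ hm hψ1 horth m hmm R hmR).comp hmono.tendsto_atTop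
  have hsum := (hnull.add hwi).add_const (ε / 2)
  have hintb : ∀ (g : K → ℝ) (C : ℝ), Measurable g → (∀ x, ‖g x‖ ≤ C) → Integrable g ν :=
    fun g C hg hC => Integrable.of_bound hg.aestronglyMeasurable C (ae_of_all _ hC)
  have hle : ∀ n, ∫ x, ψ (θ (τ n)) x * u n x ∂ν ≤
      (∫ x, ψ (θ (τ n)) x * m x ∂ν + ∫ x, w n x ∂ν) + ε / 2 := by
    intro n
    have hi1 : Integrable (fun x => ψ (θ (τ n)) x * m x) ν := by
      refine hintb _ (1 * R) ((hm _).mul hmm) fun x => ?_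
      rw [norm_mul]
      exact mul_le_mul (hψ1 _ x) (hmR x) (norm_nonneg _) zero_le_one
    have hi2 : Integrable (w n) ν := hintb _ _ (hwm n) (hwR n)
    have hi3 : Integrable (fun x => ψ (θ (τ n)) x * u n x) ν := by
      refine hintb _ (1 * R) ((hm _).mul (hum n)) fun x => ?_
      rw [norm_mul]
      exact mul_le_mul (hψ1 _ x) (huR x n) (norm_nonneg _) zero_le_one
    have hc : ∫ _ : K, ε / 2 ∂ν = ε / 2 := by simp
    rw [← integral_add hi1 hi2]
    nth_rewrite 1 [← hc]
    have hi12 : Integrable (fun x => ψ (θ (τ n)) x * m x + w n x) ν := hi1.add hi2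
    rw [← integral_add hi12 (integrable_const _)]
    refine integral_mono hi3 (hi12.add (integrable_const _)) fun x => ?_
    have h1 : ψ (θ (τ n)) x * (u n x - m x) ≤ |u n x - m x| := by
      refine (le_abs_self _).trans ?_
      rw [abs_mul]
      exact mul_le_of_le_one_left (abs_nonneg _) (hψ1 _ x)
    have h2 : |u n x - m x| - ε / 2 ≤ w n x := le_max_left _ _
    show ψ (θ (τ n)) x * u n x ≤ ψ (θ (τ n)) x * m x + w n x + ε / 2
    linarith [mul_sub (ψ (θ (τ n)) x) (u n x) (m x)]
  simp only [zero_add] at hsum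
  obtain ⟨n, hn⟩ := (hsum.eventually_lt_const (show ε / 2 < ε / 2 + t by linarith)).exists
  exact hθ2 (τ n) ((hle n).trans hn.le)

/-- The core estimate: pairing the functionals with simple selectors. -/
lemma wp_core {Ω K X : Type*} [MeasurableSpace Ω] [MeasurableSpace K] [NormedAddCommGroup X]
    [NormedSpace ℝ X] (μ : Measure Ω) [IsProbabilityMeasure μ]
    (ν : Measure K) [IsProbabilityMeasure ν]
    (ψ : ℕ → K → ℝ) (hm : ∀ n, Measurable (ψ n)) (hψ1 : ∀ n x, |ψ n x| ≤ 1)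
    (horth : ∀ n m, ∫ x, ψ n x * ψ m x ∂ν = if n = m then 1 else 0)
    {ε : ℝ} {M : Set X} (hM : IsWeaklyPrecompactWith ε M) (d : ℕ → X) (hd : ∀ j, d j ∈ M)
    (R : ℝ) (hR0 : 0 ≤ R) (hMR : ∀ j, ‖d j‖ ≤ R)
    (Λ : K → Lp X 1 μ →L[ℝ] ℝ) (hΛ1 : ∀ x, ‖Λ x‖ ≤ 1) (hΛm : ∀ F, Measurable fun x => Λ x F)
    (i : ℕ → Ω → ℕ) (hi : ∀ n, Measurable (i n)) (S : ℕ → Finset ℕ) (hiS : ∀ n ω, i n ω ∈ S n)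
    (G : ℕ → Lp X 1 μ)
    (hG : ∀ n, G n = ∑ j ∈ S n, indicatorConstLp 1 (hi n (measurableSet_singleton j))
      (measure_ne_top μ _) (d j)) (t : ℝ) (ht : 0 < t) :
    ∀ᶠ n in atTop, ∫ x, ψ n x * Λ x (G n) ∂ν ≤ ε / 2 + t := by
  classical
  obtain ⟨A, hAd⟩ : ∃ A : ∀ k, (Fin k → ℕ) → ℕ → K → ℝ, ∀ k v j x, A k v j x =
      Λ x (indicatorConstLp 1 (wpAtom_meas hi k v) (measure_ne_top μ _) (d j)) /
      μ.real (wpAtom i k v) := ⟨_, fun _ _ _ _ => rfl⟩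
  have hAm : ∀ k v j, Measurable (A k v j) := by
    intro k v j
    rw [show A k v j = _ from funext (hAd k v j)]
    exact (hΛm _).div_const _
  obtain ⟨H, hHd⟩ : ∃ H : ℕ → ℕ → Ω × K → ℝ, ∀ k j p, H k j p = A k (fun n => i n p.1) j p.2 :=
    ⟨_, fun _ _ _ => rfl⟩
  have hA : ∀ k v j x, |A k v j x| ≤ R := by
    intro k v j x
    obtain ⟨ξ, hξ, hξx⟩ := wp_avg μ (Λ x) (hΛ1 x) (wpAtom i k v) (wpAtom_meas hi k v)
    have : A k v j x = ξ (d j) := (hAd k v j x).trans (hξx (d j)).symm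
    rw [this]
    calc |ξ (d j)| ≤ ‖ξ‖ * ‖d j‖ := ξ.le_opNorm _
      _ ≤ 1 * R := mul_le_mul hξ (hMR j) (norm_nonneg _) zero_le_one
      _ = R := one_mul R
  have hHm : ∀ k j, Measurable (H k j) := by
    intro k j
    have h1 : Measurable (fun p : (Fin k → ℕ) × K => A k p.1 j p.2) :=
      measurable_from_prod_countable_right fun v => hAm k v j
    have h2 : Measurable (fun p : Ω × K => ((fun n : Fin k => i n p.1 : Fin k → ℕ), p.2)) :=
      (measurable_pi_lambda (fun (p : Ω × K) (n : Fin k) => i n p.1)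
        fun n => (hi n).comp measurable_fst).prodMk measurable_snd
    rw [show H k j = _ from funext (hHd k j)]
    exact h1.comp h2
  have hHR : ∀ k j p, |H k j p| ≤ R := fun k j p => by
    rw [hHd]
    exact hA _ _ _ _
  obtain ⟨h, hhd⟩ : ∃ h : ℕ → Ω × K → ℝ, ∀ j p, h j p = limsup (fun k => H k j p) atTop :=
    ⟨_, fun _ _ => rfl⟩
  have hhm : ∀ j, Measurable (h j) := fun j => by
    rw [show h j = _ from funext (hhd j)]
    exact Measurable.limsup fun k => hHm k j
  have hhR : ∀ j p, |h j p| ≤ R := fun j p => by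
    rw [hhd]
    exact (wp_limsup_abs fun k => hHR k j p).1
  -- joint limits
  have hset : MeasurableSet {p : Ω × K | ∀ j, Tendsto (fun k => H k j p) atTop (𝓝 (h j p))} := by
    have : {p : Ω × K | ∀ j, Tendsto (fun k => H k j p) atTop (𝓝 (h j p))} =
        ⋂ j, {p : Ω × K | Tendsto (fun k => H k j p) atTop (𝓝 (h j p))} := by
      ext p; simp
    rw [this]
    exact MeasurableSet.iInter fun j => measurableSet_tendsto_fun (fun k => hHm k j) (hhm j)
  have hlim1 : ∀ᵐ x ∂ν, ∀ᵐ ω ∂μ, ∀ j, Tendsto (fun k => H k j (ω, x)) atTop (𝓝 (h j (ω, x))) := by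
    refine ae_of_all _ fun x => ?_
    rw [ae_all_iff]
    intro j
    obtain ⟨g, -, hg, -⟩ := wp_conv μ hi (Λ x) (d j)
    filter_upwards [hg] with ω hω
    simp only [← hAd, ← hHd _ _ (ω, x)] at hω
    have : h j (ω, x) = g ω := by
      rw [hhd]
      exact Tendsto.limsup_eq hω
    rw [this]
    exact hω
  have hlim2 : ∀ᵐ ω ∂μ, ∀ᵐ x ∂ν, ∀ j, Tendsto (fun k => H k j (ω, x)) atTop (𝓝 (h j (ω, x))) :=
    (Measure.ae_ae_comm (μ := μ) (ν := ν)
      (p := fun ω x => ∀ j, Tendsto (fun k => H k j (ω, x)) atTop (𝓝 (h j (ω, x)))) hset).2 hlim1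
  -- the pairing with `G n`
  have hu : ∀ n, Measurable (fun p : Ω × K => h (i n p.1) p) := by
    intro n
    have h1 : Measurable (fun q : ℕ × (Ω × K) => h q.1 q.2) :=
      measurable_from_prod_countable_right fun j => hhm j
    exact h1.comp (((hi n).comp measurable_fst).prodMk measurable_id)
  have hpair : ∀ n x, ∫ ω, h (i n ω) (ω, x) ∂μ = Λ x (G n) := by
    intro n x
    have hint : ∀ j, Integrable (fun ω => h j (ω, x)) μ := fun j =>
      Integrable.of_bound ((hhm j).comp measurable_prodMk_right).aestronglyMeasurable R
        (ae_of_all _ fun ω => hhR j _)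
    have h1 : (fun ω => h (i n ω) (ω, x)) =
        fun ω => ∑ j ∈ S n, (i n ⁻¹' {j}).indicator (fun ω => h j (ω, x)) ω := by
      funext ω
      rw [Finset.sum_eq_single (i n ω)]
      · simp
      · intro j _ hj
        rw [Set.indicator_of_notMem]
        simpa using Ne.symm hj
      · intro hn
        exact absurd (hiS n ω) hn
    rw [h1, integral_finsetSum, hG, map_sum]
    · refine Finset.sum_congr rfl fun j _ => ?_
      obtain ⟨g, -, hg, hg2⟩ := wp_conv μ hi (Λ x) (d j)
      rw [hg2, integral_indicator (hi n (measurableSet_singleton j))]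
      refine integral_congr_ae (ae_restrict_of_ae ?_)
      filter_upwards [hg] with ω hω
      simp only [← hAd, ← hHd _ _ (ω, x)] at hω
      rw [hhd]
      exact Tendsto.limsup_eq hω
    · intro j _
      exact (hint j).indicator (hi n (measurableSet_singleton j))
  let F : ℕ → Ω → ℝ := fun n ω => ∫ x, ψ n x * h (i n ω) (ω, x) ∂ν
  have hprodm : ∀ n, Measurable (fun p : Ω × K => ψ n p.2 * h (i n p.1) p) := fun n =>
    ((hm n).comp measurable_snd).mul (hu n)
  have hprodR : ∀ n p, ‖ψ n p.2 * h (i n p.1) p‖ ≤ R := by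
    intro n p
    rw [norm_mul]
    calc _ ≤ 1 * R := mul_le_mul (hψ1 n p.2) (hhR _ p) (abs_nonneg _) zero_le_one
      _ = R := one_mul R
  have hFm : ∀ n, StronglyMeasurable (F n) := fun n =>
    (hprodm n).stronglyMeasurable.integral_prod_right' (ν := ν)
  have hFR : ∀ n ω, ‖F n ω‖ ≤ R := by
    intro n ω
    have := norm_integral_le_of_norm_le_const (μ := ν) (C := R)
      (f := fun x => ψ n x * h (i n ω) (ω, x)) (ae_of_all _ fun x => hprodR n (ω, x))
    simpa using this
  have hFint : ∀ n, ∫ ω, F n ω ∂μ = ∫ x, ψ n x * Λ x (G n) ∂ν := by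
    intro n
    have hI : Integrable (Function.uncurry fun (ω : Ω) (x : K) => ψ n x * h (i n ω) (ω, x))
        (μ.prod ν) :=
      Integrable.of_bound (hprodm n).aestronglyMeasurable R (ae_of_all _ fun p => hprodR n p)
    rw [integral_integral_swap hI]
    refine integral_congr_ae (ae_of_all _ fun x => ?_)
    simp only
    rw [integral_const_mul, hpair]
  have hpt : ∀ᵐ ω ∂μ, ∀ s : ℝ, 0 < s → ∀ᶠ n in atTop, F n ω ≤ ε / 2 + s := by
    filter_upwards [hlim2] with ω hω s hs
    refine wp_point ν ψ hm hψ1 horth hM d hd R (fun j x => h j (ω, x))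
      (fun j => (hhm j).comp measurable_prodMk_left) (fun j x => hhR j _) ?_
      (fun n => i n ω) s hs
    filter_upwards [hω] with x hx
    choose ξ hξ hξx using fun k => wp_avg μ (Λ x) (hΛ1 x) (wpAtom i k fun n => i n ω)
      (wpAtom_meas hi k _)
    refine wp_extend ξ hξ d (fun j => h j (ω, x)) fun j => ?_
    simp only [hξx]
    have := hx j
    simp only [hHd, hAd] at this
    exact this
  let w : ℕ → Ω → ℝ := fun n ω => max (F n ω - ε / 2) 0
  have hwm : ∀ n, AEStronglyMeasurable (w n) μ := fun n =>
    (((hFm n).measurable.sub_const _).max measurable_const).aestronglyMeasurable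
  have hwR : ∀ n ω, ‖w n ω‖ ≤ R + |ε / 2| := by
    intro n ω
    rw [Real.norm_of_nonneg (le_max_right _ _)]
    refine max_le ?_ (by positivity)
    have h1 := (le_abs_self _).trans (hFR n ω)
    have h4 := neg_abs_le (ε / 2)
    linarith
  have hwt : ∀ᵐ ω ∂μ, Tendsto (fun n => w n ω) atTop (𝓝 0) := by
    filter_upwards [hpt] with ω hω
    rw [Metric.tendsto_atTop']
    intro s hs
    obtain ⟨N, hN⟩ := eventually_atTop.1 (hω (s / 2) (half_pos hs))
    refine ⟨N, fun n hn => ?_⟩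
    rw [dist_zero_right, Real.norm_of_nonneg (le_max_right _ _)]
    exact max_lt (by linarith [hN n hn.le]) hs
  have hwi : Tendsto (fun n => ∫ ω, w n ω ∂μ) atTop (𝓝 0) := by
    have := tendsto_integral_of_dominated_convergence (μ := μ) (F := w) (f := fun _ => (0 : ℝ))
      (fun _ => R + |ε / 2|) hwm (integrable_const _) (fun n => ae_of_all _ (hwR n)) hwt
    simpa using this
  filter_upwards [hwi.eventually_lt_const ht] with n hn
  rw [← hFint]
  have hFi : Integrable (F n) μ :=
    Integrable.of_bound (hFm n).aestronglyMeasurable R (ae_of_all _ (hFR n))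
  have hwI : Integrable (w n) μ := Integrable.of_bound (hwm n) _ (ae_of_all _ (hwR n))
  have : ∫ ω, F n ω ∂μ ≤ ∫ ω, (w n ω + ε / 2) ∂μ := by
    refine integral_mono hFi (hwI.add (integrable_const _)) fun ω => ?_
    have : F n ω - ε / 2 ≤ w n ω := le_max_left _ _
    simp only
    linarith
  rw [integral_add hwI (integrable_const _)] at this
  simp at this
  linarith

lemma wp_approx_one {Ω X : Type*} [MeasurableSpace Ω] [NormedAddCommGroup X] [NormedSpace ℝ X]
    (μ : Measure Ω) [IsProbabilityMeasure μ] {M : Set X} (f : Lp X 1 μ)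
    (hf : ∀ᵐ ω ∂μ, f ω ∈ M) (η : ℝ) (hη : 0 < η) :
    ∃ g : SimpleFunc Ω X, (∀ ω, g ω ∈ M) ∧ ∫⁻ ω, ‖g ω - f ω‖ₑ ∂μ ≤ ENNReal.ofReal η := by
  borelize X
  have hsm := Lp.stronglyMeasurable f
  have hsep : TopologicalSpace.IsSeparable (Set.range f ∩ M) :=
    hsm.isSeparable_range.mono Set.inter_subset_left
  haveI := hsep.separableSpace
  obtain ⟨ω₀, hω₀⟩ := hf.exists
  have h0 : f ω₀ ∈ Set.range f ∩ M := ⟨⟨ω₀, rfl⟩, hω₀⟩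
  have hint : Integrable (fun ω => f ω - f ω₀) μ := (L1.integrable_coeFn f).sub (integrable_const _)
  have ht := SimpleFunc.tendsto_approxOn_L1_enorm (μ := μ) hsm.measurable h0
    (by filter_upwards [hf] with ω hω using subset_closure ⟨⟨ω, rfl⟩, hω⟩) hint.2
  obtain ⟨n, hn⟩ := (ht.eventually_lt_const (ENNReal.ofReal_pos.2 hη)).exists
  exact ⟨_, fun ω => (SimpleFunc.approxOn_mem hsm.measurable h0 n ω).2, hn.le⟩

lemma wp_approx {Ω X : Type*} [MeasurableSpace Ω] [NormedAddCommGroup X] [NormedSpace ℝ X]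
    (μ : Measure Ω) [IsProbabilityMeasure μ] {M : Set X} (f : ℕ → Lp X 1 μ)
    (hf : ∀ n, ∀ᵐ ω ∂μ, f n ω ∈ M) :
    ∃ (d : ℕ → X) (i : ℕ → Ω → ℕ) (hi : ∀ n, Measurable (i n)) (S : ℕ → Finset ℕ),
      (∀ j, d j ∈ M) ∧ (∀ n ω, i n ω ∈ S n) ∧
      ∀ n : ℕ, ‖f n - ∑ j ∈ S n, indicatorConstLp 1 (hi n (measurableSet_singleton j))
        (measure_ne_top μ _) (d j)‖ ≤ 1 / ((n : ℝ) + 1) := by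
  classical
  choose g hgM hg using fun n : ℕ => wp_approx_one μ (f n) (hf n) (1 / ((n : ℝ) + 1))
    (by positivity)
  obtain ⟨ω₀⟩ := μ.nonempty_of_neZero
  have hcount : (⋃ n, Set.range (g n)).Countable :=
    Set.countable_iUnion fun n => (g n).finite_range.countable
  have hne : (⋃ n, Set.range (g n)).Nonempty := ⟨g 0 ω₀, Set.mem_iUnion.2 ⟨0, ω₀, rfl⟩⟩
  obtain ⟨d, hd⟩ := hcount.exists_eq_range hne
  have hdM : ∀ j, d j ∈ M := by
    intro j
    have : d j ∈ ⋃ n, Set.range (g n) := hd ▸ Set.mem_range_self j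
    obtain ⟨n, ω, hω⟩ := Set.mem_iUnion.1 this
    rw [← hω]
    exact hgM n ω
  let e : X → ℕ := Function.invFun d
  have he : ∀ n ω, d (e (g n ω)) = g n ω := by
    intro n ω
    apply Function.invFun_eq
    have : g n ω ∈ ⋃ n, Set.range (g n) := Set.mem_iUnion.2 ⟨n, ω, rfl⟩
    rw [hd] at this
    exact this
  let I : ℕ → SimpleFunc Ω ℕ := fun n => (g n).map e
  have hi : ∀ n, Measurable (I n) := fun n => (I n).measurable
  have hiS : ∀ n ω, I n ω ∈ (I n).range := fun n ω => SimpleFunc.mem_range_self _ _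
  refine ⟨d, fun n => I n, hi, fun n => (I n).range, hdM, hiS, fun n => ?_⟩
  have hco : ∀ T : Finset ℕ, (∑ j ∈ T, indicatorConstLp 1 (hi n (measurableSet_singleton j))
      (measure_ne_top μ _) (d j) : Lp X 1 μ) =ᵐ[μ]
      fun ω => ∑ j ∈ T, (I n ⁻¹' {j}).indicator (fun _ => d j) ω := by
    intro T
    induction T using Finset.induction_on with
    | empty =>
      simp only [Finset.sum_empty]
      exact Lp.coeFn_zero _ _ _
    | insert a T ha ih =>
      rw [Finset.sum_insert ha]
      refine (Lp.coeFn_add _ _).trans ?_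
      filter_upwards [ih, indicatorConstLp_coeFn (p := 1) (μ := μ)
        (hs := hi n (measurableSet_singleton a)) (hμs := measure_ne_top μ _) (c := d a)]
        with ω h1 h2
      rw [Pi.add_apply, h1, h2, Finset.sum_insert ha]
  rw [L1.norm_def]
  refine ENNReal.toReal_le_of_le_ofReal (by positivity) (le_trans (le_of_eq ?_) (hg n))
  refine lintegral_congr_ae ?_
  filter_upwards [hco (I n).range, Lp.coeFn_sub (f n) (∑ j ∈ (I n).range,
    indicatorConstLp 1 (hi n (measurableSet_singleton j)) (measure_ne_top μ _) (d j))] with ω h1 h2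
  rw [h2, Pi.sub_apply, h1]
  have : ∑ j ∈ (I n).range, (I n ⁻¹' {j}).indicator (fun _ => d j) ω = g n ω := by
    rw [Finset.sum_eq_single (I n ω)]
    · simp only [Set.mem_preimage, Set.mem_singleton_iff, Set.indicator_of_mem]
      exact he n ω
    · intro j _ hj
      rw [Set.indicator_of_notMem]
      simpa using Ne.symm hj
    · intro hn
      exact absurd (hiS n ω) hn
  rw [this, ← enorm_neg, neg_sub]

theorem selectors_of_set_weaklyPrecompact
    {Ω X : Type*} [MeasurableSpace Ω] [NormedAddCommGroup X] [NormedSpace ℝ X]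
    [CompleteSpace X]
    (μ : Measure Ω) [IsProbabilityMeasure μ] (ε : ℝ) (hε : 0 ≤ ε)
    (M : Set X) (hM : IsWeaklyPrecompactWith ε M) :
    IsWeaklyPrecompactWith (2 * ε)
      {f : Lp X 1 μ | ∀ᵐ ω ∂μ, f ω ∈ M} := by
  obtain ⟨R₀, hR₀⟩ := hM.1.exists_norm_le
  obtain ⟨R, hR0, hMR⟩ : ∃ R : ℝ, 0 ≤ R ∧ ∀ x ∈ M, ‖x‖ ≤ R :=
    ⟨max R₀ 0, le_max_right _ _, fun x hx => (hR₀ x hx).trans (le_max_left _ _)⟩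
  have hnorm : ∀ f : Lp X 1 μ, (∀ᵐ ω ∂μ, f ω ∈ M) → ‖f‖ ≤ R := by
    intro f hf
    have := Lp.norm_le_of_ae_bound (f := f) (p := 1) hR0
      (by filter_upwards [hf] with ω hω using hMR _ hω)
    simpa [measureUnivNNReal] using this
  refine ⟨isBounded_iff_forall_norm_le.2 ⟨R, fun f hf => hnorm f hf⟩, fun f₀ hf₀ => ?_⟩
  by_contra hcon
  have hf₀' : ∀ n, ∀ᵐ ω ∂μ, f₀ n ω ∈ M := fun n => hf₀ n
  let B : Set (WeakDual ℝ (Lp X 1 μ)) :=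
    WeakDual.toStrongDual ⁻¹' Metric.closedBall (0 : StrongDual ℝ (Lp X 1 μ)) 1
  have hBc : IsCompact B := WeakDual.isCompact_closedBall (𝕜 := ℝ) (E := Lp X 1 μ) 0 1
  haveI : CompactSpace B := isCompact_iff_compactSpace.1 hBc
  let Λ : B → Lp X 1 μ →L[ℝ] ℝ := fun x => WeakDual.toStrongDual x.1
  have hΛ1 : ∀ x, ‖Λ x‖ ≤ 1 := fun x =>
    mem_closedBall_zero_iff.1 (show WeakDual.toStrongDual x.1 ∈
      Metric.closedBall (0 : StrongDual ℝ (Lp X 1 μ)) 1 from x.2)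
  have hΛc : ∀ F, Continuous fun x : B => Λ x F := fun F =>
    (WeakDual.eval_continuous F).comp continuous_subtype_val
  letI : MeasurableSpace B := borel B
  haveI : BorelSpace B := ⟨rfl⟩
  have hbd : ∀ x F, |Λ x F| ≤ ‖F‖ := fun x F => by
    calc |Λ x F| ≤ ‖Λ x‖ * ‖F‖ := (Λ x).le_opNorm F
      _ ≤ 1 * ‖F‖ := mul_le_mul_of_nonneg_right (hΛ1 x) (norm_nonneg _)
      _ = ‖F‖ := one_mul _
  obtain ⟨a, b, q, hab, -, hind⟩ := wp_rosenthal (fun n (x : B) => Λ x (f₀ n)) (R := R) (ε := ε)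
    (fun n x => (hbd x _).trans (hnorm _ (hf₀' n))) (by
      intro θ hθ
      by_contra hno
      push Not at hno
      refine hcon ⟨θ, hθ, fun κ hκ => ?_⟩
      have h1 := hno ⟨StrongDual.toWeakDual κ, by simpa [B] using hκ⟩
      have h2 : limsup (fun n => κ (f₀ (θ n))) atTop - liminf (fun n => κ (f₀ (θ n))) atTop ≤ ε := h1
      linarith)
  let f : ℕ → Lp X 1 μ := fun n => f₀ (q n)
  have hf : ∀ n, ∀ᵐ ω ∂μ, f n ω ∈ M := fun n => hf₀' (q n)
  obtain ⟨ν, ψ, hν, hψc, hψ1, horth, hlow⟩ := wp_measure (fun n (x : B) => Λ x (f n))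
    (fun n => hΛc _) a b (by linarith) hind
  have hψm : ∀ n, Measurable (ψ n) := fun n => (hψc n).measurable
  obtain ⟨d, i, hi, S, hdM, hiS, hG⟩ := wp_approx μ f hf
  obtain ⟨G, hGd⟩ : ∃ G : ℕ → Lp X 1 μ, ∀ n, G n = ∑ j ∈ S n,
      indicatorConstLp 1 (hi n (measurableSet_singleton j)) (measure_ne_top μ _) (d j) :=
    ⟨_, fun _ => rfl⟩
  simp only [← hGd] at hG
  obtain ⟨t, ht, hteq⟩ : ∃ t : ℝ, 0 < t ∧ 4 * t = (b - a) / 2 - ε / 2 :=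
    ⟨((b - a) / 2 - ε / 2) / 4, by linarith, by ring⟩
  have hcore := wp_core μ ν ψ hψm hψ1 horth hM d hdM R hR0 (fun j => hMR _ (hdM j)) Λ hΛ1
    (fun F => (hΛc F).measurable) i hi S hiS G hGd t ht
  have hnull := wp_weaknull ν ψ hψm hψ1 horth (fun _ => (a + b) / 2) measurable_const
    |(a + b) / 2| (fun _ => le_rfl)
  have hone : Tendsto (fun n : ℕ => 1 / ((n : ℝ) + 1)) atTop (𝓝 0) :=
    tendsto_one_div_add_atTop_nhds_zero_nat
  obtain ⟨n, hn1, hn2, hn3⟩ := (hcore.and ((hnull.eventually_const_lt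
    (show -t < 0 by linarith)).and (hone.eventually_lt_const ht))).exists
  have hintF : ∀ F : Lp X 1 μ, Integrable (fun x => ψ n x * Λ x F) ν := fun F =>
    Integrable.of_bound ((hψm n).mul (hΛc F).measurable).aestronglyMeasurable ‖F‖
      (ae_of_all _ fun x => by
        rw [norm_mul]
        calc ‖ψ n x‖ * ‖Λ x F‖ ≤ 1 * ‖F‖ :=
              mul_le_mul (hψ1 n x) (hbd x F) (abs_nonneg _) zero_le_one
          _ = ‖F‖ := one_mul _)
  have hintc : Integrable (fun x => ψ n x * ((a + b) / 2)) ν :=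
    (Integrable.of_bound (hψm n).aestronglyMeasurable 1
      (ae_of_all _ fun x => hψ1 n x)).mul_const _
  have hl := hlow n
  have e1 : ∫ x, ψ n x * (Λ x (f n) - (a + b) / 2) ∂ν =
      ∫ x, ψ n x * Λ x (f n) ∂ν - ∫ x, ψ n x * ((a + b) / 2) ∂ν := by
    rw [← integral_sub (hintF _) hintc]
    simp only [mul_sub]
  have e2 : ∫ x, ψ n x * Λ x (f n) ∂ν =
      ∫ x, ψ n x * Λ x (G n) ∂ν + ∫ x, ψ n x * Λ x (f n - G n) ∂ν := by
    rw [← integral_add (hintF _) (hintF _)]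
    simp only [map_sub]
    congr 1
    funext x
    ring
  have e3 : ∫ x, ψ n x * Λ x (f n - G n) ∂ν ≤ ‖f n - G n‖ := by
    have : ∫ x, ψ n x * Λ x (f n - G n) ∂ν ≤ ∫ _ : B, ‖f n - G n‖ ∂ν := by
      refine integral_mono (hintF _) (integrable_const _) fun x => ?_
      refine (le_abs_self _).trans ?_
      simp only [abs_mul]
      calc |ψ n x| * |Λ x (f n - G n)| ≤ 1 * ‖f n - G n‖ :=
              mul_le_mul (hψ1 n x) (hbd x _) (abs_nonneg _) zero_le_one
          _ = ‖f n - G n‖ := one_mul _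
    simpa using this
  have e4 := hG n
  linarith
end

section
/- Let (Ω,Σ,μ) be a probability space, X a real Banach space, and ε ≥ 0. Then every δC_ε-set of L¹(μ,X) is 2ε-weakly precompact in L¹(μ,X). -/
open Filter Topology MeasureTheory

/-- `(x_n)` is an `ℓ₁`-sequence with constant `c`. -/
def IsL1SeqWith {E : Type*} [NormedAddCommGroup E] [NormedSpace ℝ E]
    (c : ℝ) (x : ℕ → E) : Prop :=
  Bornology.IsBounded (Set.range x) ∧
    ∀ (m : ℕ) (a : ℕ → ℝ),
      c * ∑ n ∈ Finset.range m, |a n| ≤ ‖∑ n ∈ Finset.range m, a n • x n‖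

/-- A set `W ⊆ L¹(μ,X)` is uniformly integrable: it is bounded and for every `η > 0`
there is `δ > 0` such that `∫_A ‖f‖ dμ ≤ η` for all `f ∈ W` and all `A` with `μ(A) ≤ δ`. -/
def UnifIntegrableSet {Ω X : Type*} [MeasurableSpace Ω] [NormedAddCommGroup X]
    (μ : Measure Ω) (W : Set (Lp X 1 μ)) : Prop :=
  Bornology.IsBounded W ∧
    ∀ η : ℝ, 0 < η → ∃ δ : ℝ, 0 < δ ∧
      ∀ f ∈ W, ∀ A : Set Ω, MeasurableSet A → μ A ≤ ENNReal.ofReal δ →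
        ∫ ω in A, ‖f ω‖ ∂μ ≤ η


/-- `W ⊆ L¹(μ,X)` is a `δC_ε`-set: it is uniformly integrable and for each `δ > 0`
there is an `ε`-weakly precompact set `M ⊆ X` such that every `f ∈ W` coincides a.e.
on some set `A` of measure `≥ 1 − δ` with a function taking values in `M`. -/
def IsDeltaCSet {Ω X : Type*} [MeasurableSpace Ω] [NormedAddCommGroup X] [NormedSpace ℝ X]
    (μ : Measure Ω) (ε : ℝ) (W : Set (Lp X 1 μ)) : Prop :=
  UnifIntegrableSet μ W ∧
    ∀ δ : ℝ, 0 < δ → ∃ M : Set X, IsWeaklyPrecompactWith ε M ∧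
      ∀ f ∈ W, ∃ A : Set Ω, MeasurableSet A ∧ ENNReal.ofReal (1 - δ) ≤ μ A ∧
        ∀ᵐ ω ∂μ, ω ∈ A → f ω ∈ M


lemma aux_diag (Q : ℕ → Set ℕ → Prop)
    (her : ∀ i M N, N ⊆ M → N.Infinite → Q i M → Q i N)
    (dense : ∀ i M, M.Infinite → ∃ N, N ⊆ M ∧ N.Infinite ∧ Q i N)
    (M : Set ℕ) (hM : M.Infinite) :
    ∃ N, N ⊆ M ∧ N.Infinite ∧ ∀ i, ∃ m, Q i (N ∩ Set.Ici m) := by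
  choose F hF1 hF2 hF3 using dense
  let S : ℕ → {S : Set ℕ // S.Infinite} := fun i =>
    Nat.rec ⟨F 0 M hM, hF2 0 M hM⟩ (fun i S => ⟨F (i+1) S.1 S.2, hF2 (i+1) S.1 S.2⟩) i
  have hS0 : (S 0).1 ⊆ M := hF1 0 M hM
  have hSs : ∀ i, (S (i+1)).1 ⊆ (S i).1 := fun i => hF1 (i+1) (S i).1 (S i).2
  have hSQ : ∀ i, Q i (S i).1 := by
    intro i
    cases i with
    | zero => exact hF3 0 M hM
    | succ i => exact hF3 (i+1) (S i).1 (S i).2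
  have hanti : Antitone (fun i => (S i).1) := antitone_nat_of_succ_le hSs
  have hpick : ∀ i k, ∃ n ∈ (S i).1, k < n := fun i k => (S i).2.exists_gt k
  choose pick hp1 hp2 using hpick
  let n : ℕ → ℕ := fun i => Nat.rec (pick 0 0) (fun i k => pick (i+1) k) i
  have hnS : ∀ i, n i ∈ (S i).1 := by
    intro i
    cases i with
    | zero => exact hp1 0 0
    | succ i => exact hp1 (i+1) (n i)
  have hmono : StrictMono n := strictMono_nat_of_lt_succ (fun i => hp2 (i+1) (n i))
  have hinf : (Set.range n).Infinite := Set.infinite_range_of_injective hmono.injective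
  refine ⟨Set.range n, ?_, hinf, fun i => ⟨n i, ?_⟩⟩
  · rintro _ ⟨i, rfl⟩
    exact hS0 (hanti (Nat.zero_le i) (hnS i))
  · refine her i _ _ ?_ ?_ (hSQ i)
    · rintro _ ⟨⟨j, rfl⟩, hj⟩
      exact hanti (hmono.le_iff_le.mp hj) (hnS j)
    · have : Set.range n ∩ Set.Ici (n i) = Set.range n \ Set.Iio (n i) := by
        ext; simp
      rw [this]
      exact hinf.sdiff (Set.finite_Iio _)

open Classical in
lemma aux_ramsey (Bad : Finset ℕ → Prop)
    (h : ∀ L : Set ℕ, L.Infinite → ∃ L', L' ⊆ L ∧ L'.Infinite ∧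
      ∀ m, ¬ Bad ((Finset.range m).filter (· ∈ L'))) :
    ∃ φ : ℕ → ℕ, StrictMono φ ∧ ∀ F : Finset ℕ, ↑F ⊆ Set.range φ → ¬ Bad F := by
  let O : Set ℕ → Prop := fun L => ∃ m, Bad ((Finset.range m).filter (· ∈ L))
  let Acc : Set ℕ → Finset ℕ → Prop := fun M s =>
    ∀ L, L ⊆ M → L.Infinite → (∀ i ∈ s, ∀ l ∈ L, i < l) → O (↑s ∪ L)
  have hAcc : ∀ M N s, N ⊆ M → Acc M s → Acc N s := fun M N s hNM hA L hL => hA L (hL.trans hNM)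
  let Rej : Set ℕ → Finset ℕ → Prop := fun M s => ∀ N, N ⊆ M → N.Infinite → ¬ Acc N s
  obtain ⟨e, he⟩ := exists_surjective_nat (Finset ℕ)
  obtain ⟨M, -, hM, hdec⟩ := aux_diag (fun i M => Acc M (e i) ∨ Rej M (e i))
    (by
      intro i M N hNM _ hQ
      rcases hQ with hQ | hQ
      · exact Or.inl (hAcc _ _ _ hNM hQ)
      · exact Or.inr fun N' hN' => hQ N' (hN'.trans hNM))
    (by
      intro i M hM
      by_cases hR : Rej M (e i)
      · exact ⟨M, subset_rfl, hM, Or.inr hR⟩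
      · simp only [Rej, not_forall, not_not] at hR
        obtain ⟨N, h1, h2, h3⟩ := hR
        exact ⟨N, h1, h2, Or.inl h3⟩) Set.univ Set.infinite_univ
  have hIci : ∀ (N : Set ℕ) m, N.Infinite → (N ∩ Set.Ici m).Infinite := by
    intro N m hN
    have : N ∩ Set.Ici m = N \ Set.Iio m := by ext; simp
    rw [this]; exact hN.sdiff (Set.finite_Iio _)
  have hdec' : ∀ s, (∃ m, Acc (M ∩ Set.Ici m) s) ∨ Rej M s := by
    intro s
    obtain ⟨i, rfl⟩ := he s
    obtain ⟨m, hm | hm⟩ := hdec i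
    · exact Or.inl ⟨m, hm⟩
    · refine Or.inr fun N hN hNi hA => ?_
      exact hm (N ∩ Set.Ici m) (Set.inter_subset_inter_left _ hN) (hIci _ _ hNi)
        (hAcc _ _ _ Set.inter_subset_left hA)
  have hempty : Rej M ∅ := by
    intro N hN hNi hA
    obtain ⟨L', h1, h2, h3⟩ := h N hNi
    obtain ⟨m, hm⟩ := hA L' h1 h2 (by simp)
    simp only [Finset.coe_empty, Set.empty_union] at hm
    exact h3 m hm
  have hstep : ∀ s, Rej M s → {n ∈ M | (∀ i ∈ s, i < n) ∧ ¬ Rej M (insert n s)}.Finite := by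
    intro s hs
    by_contra hinf
    have hinf : {n ∈ M | (∀ i ∈ s, i < n) ∧ ¬ Rej M (insert n s)}.Infinite := hinf
    have hex : ∀ n, ∃ m, n ∈ {n ∈ M | (∀ i ∈ s, i < n) ∧ ¬ Rej M (insert n s)} →
        Acc (M ∩ Set.Ici m) (insert n s) := by
      intro n
      by_cases hn : n ∈ {n ∈ M | (∀ i ∈ s, i < n) ∧ ¬ Rej M (insert n s)}
      · obtain ⟨m, hm⟩ := (hdec' (insert n s)).resolve_right hn.2.2
        exact ⟨m, fun _ => hm⟩
      · exact ⟨0, fun h => absurd h hn⟩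
    choose m hm using hex
    have hpick : ∀ k, ∃ n ∈ {n ∈ M | (∀ i ∈ s, i < n) ∧ ¬ Rej M (insert n s)}, k < n :=
      fun k => hinf.exists_gt k
    choose pick hp1 hp2 using hpick
    let n : ℕ → ℕ := fun i => Nat.rec (pick 0) (fun _ k => pick (max k (m k))) i
    have hn1 : ∀ i, n i ∈ {n ∈ M | (∀ i ∈ s, i < n) ∧ ¬ Rej M (insert n s)} := by
      intro i
      cases i with
      | zero => exact hp1 _
      | succ i => exact hp1 _
    have hn2 : ∀ i, max (n i) (m (n i)) < n (i+1) := fun i => hp2 _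
    have hmono : StrictMono n := strictMono_nat_of_lt_succ
      (fun i => (le_max_left _ _).trans_lt (hn2 i))
    refine hs (Set.range n) ?_ (Set.infinite_range_of_injective hmono.injective) ?_
    · rintro _ ⟨i, rfl⟩; exact (hn1 i).1
    · intro L hL hLi hsL
      obtain ⟨l0, hl0, hmin⟩ : ∃ l ∈ L, ∀ l' ∈ L, l ≤ l' :=
        ⟨sInf L, Nat.sInf_mem hLi.nonempty, fun l' hl' => Nat.sInf_le hl'⟩
      obtain ⟨i, rfl⟩ := hL hl0
      have := hm (n i) (hn1 i) (L \ {n i}) ?_ (hLi.sdiff (Set.finite_singleton _)) ?_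
      · have heq : (↑(insert (n i) s) ∪ L \ {n i} : Set ℕ) = ↑s ∪ L := by
          ext x
          simp only [Finset.coe_insert, Set.mem_union, Set.mem_insert_iff, Set.mem_sdiff,
            Set.mem_singleton_iff]
          rcases eq_or_ne x (n i) with hx | hx
          · subst hx; simp [hl0]
          · simp [hx]
        rwa [heq] at this
      · rintro l ⟨hl, hne⟩
        obtain ⟨j, rfl⟩ := hL hl
        refine ⟨(hn1 j).1, ?_⟩
        have hij : i < j := by
          refine lt_of_le_of_ne (hmono.le_iff_le.mp (hmin _ hl)) ?_
          rintro rfl; exact hne rfl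
        have h1 : n (i+1) ≤ n j := hmono.le_iff_le.mpr hij
        exact ((le_max_right _ _).trans (hn2 i).le).trans h1
      · intro k hk l hl
        rcases Finset.mem_insert.mp hk with rfl | hk
        · exact lt_of_le_of_ne (hmin l hl.1) (fun h => hl.2 h.symm)
        · exact hsL k hk l hl.1
  -- build the thin subset
  have hpick : ∀ (T : Finset ℕ) , ∃ n ∈ M, (∀ i ∈ T, i < n) ∧
      ∀ s, s ⊆ T → Rej M s → Rej M (insert n s) := by
    intro T
    have hfin : (⋃ s ∈ {s | s ∈ T.powerset ∧ Rej M s},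
        {n ∈ M | (∀ i ∈ s, i < n) ∧ ¬ Rej M (insert n s)}).Finite := by
      refine Set.Finite.biUnion ?_ (fun s hs => hstep s hs.2)
      exact (T.powerset.finite_toSet).subset (fun s hs => hs.1)
    obtain ⟨n, hn, hn'⟩ := (hM.sdiff (hfin.union (Set.finite_Iic (T.sup id)))).nonempty
    have hlt : ∀ i ∈ T, i < n := by
      intro i hi
      have h1 : i ≤ T.sup id := Finset.le_sup (f := id) hi
      have h2 : ¬ n ≤ T.sup id := fun h => hn' (Or.inr h)
      omega
    refine ⟨n, hn, hlt, fun s hs hR => ?_⟩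
    by_contra hcon
    refine hn' (Or.inl ?_)
    simp only [Set.mem_iUnion]
    exact ⟨s, ⟨Finset.mem_powerset.mpr hs, hR⟩, hn, fun i hi => hlt i (hs hi), hcon⟩
  choose pick hp1 hp2 hp3 using hpick
  let T : ℕ → Finset ℕ := fun i => Nat.rec ∅ (fun _ T => insert (pick T) T) i
  have hT : ∀ i, T (i+1) = insert (pick (T i)) (T i) := fun i => rfl
  have hTrej : ∀ i, ∀ s, s ⊆ T i → Rej M s := by
    intro i
    induction i with
    | zero =>
      intro s hs
      have : s = ∅ := Finset.subset_empty.mp hs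
      rw [this]; exact hempty
    | succ i ih =>
      intro s hs
      rw [hT] at hs
      by_cases hmem : pick (T i) ∈ s
      · have h1 : s.erase (pick (T i)) ⊆ T i := by
          rw [Finset.subset_insert_iff] at hs; exact hs
        have := hp3 (T i) _ h1 (ih _ h1)
        rwa [Finset.insert_erase hmem] at this
      · exact ih s ((Finset.subset_insert_iff_of_notMem hmem).mp hs)
  have hTmono : Monotone T := monotone_nat_of_le_succ
    (fun i => by rw [hT]; exact Finset.subset_insert _ _)
  have hTin : ∀ i, pick (T i) ∈ T (i+1) := fun i => by rw [hT]; exact Finset.mem_insert_self _ _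
  have hmono : StrictMono (fun i => pick (T i)) := strictMono_nat_of_lt_succ
    (fun i => hp2 _ _ (hTin i))
  refine ⟨_, hmono, fun F hF hbad => ?_⟩
  have hFT : ∀ F : Finset ℕ, ↑F ⊆ Set.range (fun i => pick (T i)) → ∃ i, F ⊆ T i := by
    intro F
    induction F using Finset.induction_on with
    | empty => intro _; exact ⟨0, by simp⟩
    | insert a F ha ih =>
      intro hF
      rw [Finset.coe_insert, Set.insert_subset_iff] at hF
      obtain ⟨i, hi⟩ := ih hF.2
      obtain ⟨j, rfl⟩ := hF.1
      refine ⟨max i (j+1), Finset.insert_subset ?_ ?_⟩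
      · exact hTmono (le_max_right _ _) (hTin j)
      · exact hi.trans (hTmono (le_max_left _ _))
  obtain ⟨i, hi⟩ := hFT F hF
  refine hTrej i F hi (M ∩ Set.Ici ((F.sup id)+1)) Set.inter_subset_left (hIci _ _ hM) ?_
  intro L hL hLi hFL
  refine ⟨F.sup id + 1, ?_⟩
  have : (Finset.range (F.sup id + 1)).filter (· ∈ (↑F ∪ L : Set ℕ)) = F := by
    ext x
    simp only [Finset.mem_filter, Finset.mem_range, Set.mem_union, Finset.mem_coe]
    constructor
    · rintro ⟨h1, h2 | h2⟩
      · exact h2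
      · have := (hL h2).2
        simp only [Set.mem_Ici] at this
        omega
    · intro hx
      have h1 : x ≤ F.sup id := Finset.le_sup (f := id) hx
      exact ⟨by omega, Or.inl hx⟩
  convert hbad
  convert this

/-- No functional of norm at most one crosses a gap larger than `c` infinitely often along `L`. -/
def OscOn {E : Type*} [NormedAddCommGroup E] [NormedSpace ℝ E] (L : Set ℕ) (x : ℕ → E) (c : ℝ) :
    Prop :=
  ∀ f : E →L[ℝ] ℝ, ‖f‖ ≤ 1 → ∀ a b : ℝ, c < b - a →
    ¬ ({n ∈ L | f (x n) < a}.Infinite ∧ {n ∈ L | b < f (x n)}.Infinite)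

lemma aux_inter_Ici (N : Set ℕ) (m : ℕ) (hN : N.Infinite) : (N ∩ Set.Ici m).Infinite := by
  have : N ∩ Set.Ici m = N \ Set.Iio m := by ext; simp
  rw [this]; exact hN.sdiff (Set.finite_Iio _)

lemma aux_step1 {E : Type*} [NormedAddCommGroup E] [NormedSpace ℝ E] (x : ℕ → E) (c : ℝ)
    (hno : ∀ N : Set ℕ, N.Infinite → ¬ OscOn N x c) :
    ∃ a b : ℝ, c < b - a ∧ ∃ M : Set ℕ, M.Infinite ∧ ∀ N, N ⊆ M → N.Infinite →
      ∃ f : E →L[ℝ] ℝ, ‖f‖ ≤ 1 ∧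
        {n ∈ N | f (x n) < a}.Infinite ∧ {n ∈ N | b < f (x n)}.Infinite := by
  by_contra hcon
  obtain ⟨e, he⟩ := exists_surjective_nat (ℚ × ℚ)
  obtain ⟨N, -, hN, hQ⟩ := aux_diag (fun i M => c < ((e i).2 : ℝ) - (e i).1 →
      ∀ f : E →L[ℝ] ℝ, ‖f‖ ≤ 1 →
        ¬ ({n ∈ M | f (x n) < (e i).1}.Infinite ∧ {n ∈ M | ((e i).2 : ℝ) < f (x n)}.Infinite))
    (by
      intro i M N hNM _ hQ hc f hf h
      exact hQ hc f hf ⟨h.1.mono fun n hn => ⟨hNM hn.1, hn.2⟩,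
        h.2.mono fun n hn => ⟨hNM hn.1, hn.2⟩⟩)
    (by
      intro i M hM
      by_contra hc
      push Not at hc
      have hcc : c < ((e i).2 : ℝ) - (e i).1 := (hc M subset_rfl hM).1
      refine hcon ⟨(e i).1, (e i).2, hcc, M, hM, fun N h1 h2 => ?_⟩
      obtain ⟨_, f, hf, h3, h4⟩ := hc N h1 h2
      exact ⟨f, hf, h3, h4⟩)
    Set.univ Set.infinite_univ
  refine hno N hN fun f hf a b hab h => ?_
  obtain ⟨p, hp1, hp2⟩ := exists_rat_btwn (show a < a + (b - a - c) / 2 by linarith)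
  obtain ⟨q, hq1, hq2⟩ := exists_rat_btwn (show b - (b - a - c) / 2 < b by linarith)
  obtain ⟨i, hi⟩ := he (p, q)
  obtain ⟨m, hm⟩ := hQ i
  rw [hi] at hm
  refine hm (by simp only; linarith) f hf ⟨?_, ?_⟩
  · refine (aux_inter_Ici _ m h.1).mono ?_
    rintro n ⟨⟨h1, h2⟩, h3⟩
    exact ⟨⟨h1, h3⟩, h2.trans hp1⟩
  · refine (aux_inter_Ici _ m h.2).mono ?_
    rintro n ⟨⟨h1, h2⟩, h3⟩
    exact ⟨⟨h1, h3⟩, hq2.trans h2⟩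

open Classical in
lemma aux_pattern (t : ℕ → Bool) (N : ℕ) : ∃ I : Finset ℕ, ∀ n < N, 2*n+1 ∈ I ∧
    (Even ((I.filter (· < 2*n+1)).card) ↔ t n = true) := by
  suffices h : ∃ I : Finset ℕ, (∀ i ∈ I, i < 2 * N) ∧ ∀ n < N, 2*n+1 ∈ I ∧
    (Even ((I.filter (· < 2*n+1)).card) ↔ t n = true) by
    obtain ⟨I, _, h⟩ := h; exact ⟨I, h⟩
  induction N with
  | zero => exact ⟨∅, by simp, by simp⟩
  | succ N ih =>
    obtain ⟨I, hI, h⟩ := ih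
    obtain ⟨J, hJ1, hJ2, hJ3⟩ : ∃ J : Finset ℕ, (∀ i, i < 2*N → (i ∈ J ↔ i ∈ I)) ∧
        (∀ i ∈ J, i < 2*N+1) ∧ (Even J.card ↔ t N = true) := by
      by_cases hp : (Even I.card ↔ t N = true)
      · exact ⟨I, fun i _ => Iff.rfl, fun i hi => (hI i hi).trans (by omega), hp⟩
      · refine ⟨insert (2*N) I, fun i hi => ?_, fun i hi => ?_, ?_⟩
        · rw [Finset.mem_insert]
          constructor
          · rintro (h | h)
            · omega
            · exact h
          · exact Or.inr
        · rcases Finset.mem_insert.mp hi with h | h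
          · omega
          · exact (hI i h).trans (by omega)
        · rw [Finset.card_insert_of_notMem (fun h => lt_irrefl _ (hI _ h)), Nat.even_add_one]
          tauto
    refine ⟨insert (2*N+1) J, ?_, ?_⟩
    · intro i hi
      rcases Finset.mem_insert.mp hi with h | h
      · omega
      · exact (hJ2 i h).trans (by omega)
    · intro n hn
      rcases Nat.lt_succ_iff_lt_or_eq.mp hn with hn | rfl
      · refine ⟨Finset.mem_insert_of_mem ((hJ1 _ (by omega)).mpr (h n hn).1), ?_⟩
        rw [← (h n hn).2]
        have : (insert (2*N+1) J).filter (· < 2*n+1) = I.filter (· < 2*n+1) := by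
          ext i
          simp only [Finset.mem_filter, Finset.mem_insert]
          constructor
          · rintro ⟨h1 | h1, h2⟩
            · omega
            · exact ⟨(hJ1 _ (by omega)).mp h1, h2⟩
          · rintro ⟨h1, h2⟩
            exact ⟨Or.inr ((hJ1 _ (by omega)).mpr h1), h2⟩
        rw [this]
      · refine ⟨Finset.mem_insert_self _ _, ?_⟩
        rw [← hJ3]
        have : (insert (2*n+1) J).filter (· < 2*n+1) = J := by
          ext i
          simp only [Finset.mem_filter, Finset.mem_insert]
          constructor
          · rintro ⟨h1 | h1, h2⟩
            · omega
            · exact h1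
          · intro h1
            exact ⟨Or.inr h1, hJ2 i h1⟩
        rw [this]

open Classical in
lemma aux_rosenthal {E : Type*} [NormedAddCommGroup E] [NormedSpace ℝ E] (x : ℕ → E) (c : ℝ)
    (hno : ∀ N : Set ℕ, N.Infinite → ¬ OscOn N x c) :
    ∃ a b : ℝ, c < b - a ∧ ∃ φ : ℕ → ℕ, StrictMono φ ∧ ∀ (N : ℕ) (t : ℕ → Bool),
      ∃ f : E →L[ℝ] ℝ, ‖f‖ ≤ 1 ∧ ∀ n < N, (t n = true → b < f (x (φ n))) ∧
        (t n = false → f (x (φ n)) < a) := by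
  obtain ⟨a, b, hab, M, hM, hcross⟩ := aux_step1 x c hno
  refine ⟨a, b, hab, ?_⟩
  let ψ : ℕ → ℕ := Nat.nth (· ∈ M)
  have hψ : StrictMono ψ := Nat.nth_strictMono hM
  have hψM : ∀ k, ψ k ∈ M := fun k => Nat.nth_mem_of_infinite hM k
  have hcross' : ∀ L : Set ℕ, L.Infinite → ∃ f : E →L[ℝ] ℝ, ‖f‖ ≤ 1 ∧
        {n ∈ L | f (x (ψ n)) < a}.Infinite ∧ {n ∈ L | b < f (x (ψ n))}.Infinite := by
    intro L hL
    obtain ⟨f, hf, h1, h2⟩ := hcross (ψ '' L) (by rintro _ ⟨k, _, rfl⟩; exact hψM k)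
      (hL.image hψ.injective.injOn)
    refine ⟨f, hf, ?_, ?_⟩
    · refine Set.Infinite.of_image ψ (h1.mono ?_)
      rintro _ ⟨⟨k, hk, rfl⟩, h⟩
      exact ⟨k, ⟨hk, h⟩, rfl⟩
    · refine Set.Infinite.of_image ψ (h2.mono ?_)
      rintro _ ⟨⟨k, hk, rfl⟩, h⟩
      exact ⟨k, ⟨hk, h⟩, rfl⟩
  obtain ⟨χ, hχ, hgood⟩ := aux_ramsey (fun F => ¬ ∃ f : E →L[ℝ] ℝ, ‖f‖ ≤ 1 ∧ ∀ i ∈ F,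
      (Even ((F.filter (· < i)).card) → b < f (x (ψ i))) ∧
      (¬ Even ((F.filter (· < i)).card) → f (x (ψ i)) < a)) (by
    intro L hL
    obtain ⟨f, hf, h1, h2⟩ := hcross' L hL
    have hpick : ∀ (k m : ℕ), ∃ n, m < n ∧ n ∈ L ∧ (Even k → b < f (x (ψ n))) ∧
        (¬ Even k → f (x (ψ n)) < a) := by
      intro k m
      by_cases hk : Even k
      · obtain ⟨n, hn, hmn⟩ := h2.exists_gt m
        exact ⟨n, hmn, hn.1, fun _ => hn.2, fun h => absurd hk h⟩
      · obtain ⟨n, hn, hmn⟩ := h1.exists_gt m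
        exact ⟨n, hmn, hn.1, fun h => absurd h hk, fun _ => hn.2⟩
    choose pick hp1 hp2 hp3 hp4 using hpick
    obtain ⟨n, hmono, hn⟩ : ∃ n : ℕ → ℕ, StrictMono n ∧ ∀ k, n k ∈ L ∧
        (Even k → b < f (x (ψ (n k)))) ∧ (¬ Even k → f (x (ψ (n k))) < a) := by
      let n : ℕ → ℕ := fun i => Nat.rec (pick 0 0) (fun i k => pick (i+1) k) i
      refine ⟨n, strictMono_nat_of_lt_succ (fun i => hp1 (i+1) (n i)), ?_⟩
      intro k
      cases k with
      | zero => exact ⟨hp2 0 0, hp3 0 0, hp4 0 0⟩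
      | succ k => exact ⟨hp2 (k+1) (n k), hp3 (k+1) (n k), hp4 (k+1) (n k)⟩
    refine ⟨Set.range n, ?_, Set.infinite_range_of_injective hmono.injective, ?_⟩
    · rintro _ ⟨k, rfl⟩; exact (hn k).1
    · intro m
      rw [not_not]
      refine ⟨f, hf, ?_⟩
      intro i hi
      obtain ⟨him, k, rfl⟩ := Finset.mem_filter.mp hi
      have : (((Finset.range m).filter (fun j : ℕ => j ∈ Set.range n)).filter (fun j : ℕ => j < n k)) =
          (Finset.range k).image n := by
        ext j
        simp only [Finset.mem_filter, Finset.mem_range, Finset.mem_image]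
        constructor
        · rintro ⟨⟨_, l, rfl⟩, h⟩
          exact ⟨l, hmono.lt_iff_lt.mp h, rfl⟩
        · rintro ⟨l, hl, rfl⟩
          have := hmono hl
          exact ⟨⟨this.trans (Finset.mem_range.mp him), l, rfl⟩, this⟩
      have hcard : (((Finset.range m).filter (fun j : ℕ => j ∈ Set.range n)).filter (fun j : ℕ => j < n k)).card = k := by
        rw [this, Finset.card_image_of_injective _ hmono.injective, Finset.card_range]
      rw [hcard]
      exact (hn k).2)
  refine ⟨fun n => ψ (χ (2*n+1)), fun i j hij => hψ (hχ (by omega)), ?_⟩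
  intro N t
  obtain ⟨I, hI⟩ := aux_pattern t N
  have := hgood (I.image χ) (by
    intro j hj
    obtain ⟨i, _, rfl⟩ := Finset.mem_image.mp (Finset.mem_coe.mp hj)
    exact ⟨i, rfl⟩)
  rw [not_not] at this
  obtain ⟨f, hf, h⟩ := this
  refine ⟨f, hf, fun n hn => ?_⟩
  have h1 := h (χ (2*n+1)) (Finset.mem_image_of_mem _ (hI n hn).1)
  have h2 : ((I.image χ).filter (· < χ (2*n+1))).card = (I.filter (· < 2*n+1)).card := by
    rw [Finset.filter_image, Finset.card_image_of_injective _ hχ.injective]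
    simp only [hχ.lt_iff_lt]
  rw [h2, (hI n hn).2] at h1
  exact ⟨h1.1, fun ht => h1.2 (by simp [ht])⟩

lemma aux_weaklyNull {Δ : Type*} [MeasurableSpace Δ] (ν : Measure Δ) [IsProbabilityMeasure ν]
    (r : ℕ → Δ → ℝ) (hr : ∀ n, Measurable (r n)) (hr1 : ∀ n t, r n t * r n t = 1)
    (horth : ∀ n m, n ≠ m → ∫ t, r n t * r m t ∂ν = 0) (w : Δ → ℝ) (hw : MemLp w 2 ν) :
    Tendsto (fun n => ∫ t, r n t * w t ∂ν) atTop (𝓝 0) := by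
  have hrb : ∀ n t, ‖r n t‖ ≤ 1 := by
    intro n t
    rw [Real.norm_eq_abs]
    have := hr1 n t
    rw [abs_le]; constructor <;> nlinarith
  have hmem : ∀ n, MemLp (r n) 2 ν := fun n =>
    MemLp.of_bound (hr n).aestronglyMeasurable 1 (ae_of_all _ (hrb n))
  have hinner : ∀ (f g : Δ → ℝ) (hf : MemLp f 2 ν) (hg : MemLp g 2 ν),
      inner ℝ (hf.toLp f) (hg.toLp g) = ∫ t, f t * g t ∂ν := by
    intro f g hf hg
    rw [L2.inner_def]
    refine integral_congr_ae ?_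
    filter_upwards [hf.coeFn_toLp, hg.coeFn_toLp] with t h1 h2
    rw [h1, h2]
    simp [mul_comm]
  have hon : Orthonormal ℝ (fun n => (hmem n).toLp (r n)) := by
    classical
    rw [orthonormal_iff_ite]
    intro i j
    rw [hinner]
    split_ifs with h
    · subst h; simp [hr1]
    · exact horth i j h
  have hs := (hon.inner_products_summable (hw.toLp w)).tendsto_atTop_zero
  simp only [hinner] at hs
  have h2 := hs.sqrt
  simp only [Real.sqrt_zero] at h2
  refine tendsto_zero_iff_norm_tendsto_zero.mpr (h2.congr fun n => ?_)
  rw [Real.sqrt_sq (norm_nonneg _)]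

lemma aux_helly {X : Type*} [NormedAddCommGroup X] [NormedSpace ℝ X] (x : ℕ → X) (u : ℕ → ℝ)
    (h : ∀ (m : ℕ) (a : Fin m → ℚ), ∑ i, (a i : ℝ) * u i ≤ ‖∑ i, (a i : ℝ) • x i‖) :
    ∃ f : X →L[ℝ] ℝ, ‖f‖ ≤ 1 ∧ ∀ n, f (x n) = u n := by
  have hreal : ∀ (m : ℕ) (a : Fin m → ℝ), ∑ i, a i * u i ≤ ‖∑ i, a i • x i‖ := by
    intro m a
    have hd : DenseRange (Pi.map (fun (_ : Fin m) (q : ℚ) => (q : ℝ))) :=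
      DenseRange.piMap (fun _ => Rat.denseRange_cast)
    have hc : IsClosed {a : Fin m → ℝ | ∑ i, a i * u i ≤ ‖∑ i, a i • x i‖} :=
      isClosed_le (by fun_prop) (by fun_prop)
    have : ∀ a, a ∈ {a : Fin m → ℝ | ∑ i, a i * u i ≤ ‖∑ i, a i • x i‖} := fun a =>
      hd.induction_on (p := fun a => a ∈ {a : Fin m → ℝ | ∑ i, a i * u i ≤ ‖∑ i, a i • x i‖})
        a hc (fun q => h m q)
    exact this a
  let L := Finsupp.linearCombination ℝ x
  let l := Finsupp.linearCombination ℝ u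
  have hle : ∀ a, l a ≤ ‖L a‖ := by
    intro a
    let m := a.support.sup id + 1
    have hm : a.support ⊆ Finset.range m := by
      intro i hi
      have h1 : i ≤ a.support.sup id := Finset.le_sup (f := id) hi
      exact Finset.mem_range.mpr (by simp only [m]; omega)
    have h1 : l a = ∑ i : Fin m, a i * u i := by
      simp only [l, Finsupp.linearCombination_apply]
      rw [Finsupp.sum_of_support_subset a hm _ (by simp), Finset.sum_range]
      simp
    have h2 : L a = ∑ i : Fin m, a i • x i := by
      simp only [L, Finsupp.linearCombination_apply]
      rw [Finsupp.sum_of_support_subset a hm _ (by simp), Finset.sum_range]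
    rw [h1, h2]
    exact hreal m _
  have hle' : ∀ a, |l a| ≤ ‖L a‖ := by
    intro a
    rw [abs_le']
    refine ⟨hle a, ?_⟩
    have := hle (-a)
    rwa [map_neg, map_neg, norm_neg] at this
  have hker : LinearMap.ker L ≤ LinearMap.ker l := by
    intro a ha
    have := hle' a
    rw [LinearMap.mem_ker.mp ha, norm_zero] at this
    exact LinearMap.mem_ker.mpr (abs_nonpos_iff.mp this)
  let f0 : LinearMap.range L →ₗ[ℝ] ℝ :=
    ((LinearMap.ker L).liftQ l hker).comp L.quotKerEquivRange.symm.toLinearMap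
  have hf0 : ∀ a, f0 ⟨L a, LinearMap.mem_range_self L a⟩ = l a := by
    intro a
    simp only [f0, LinearMap.comp_apply, LinearEquiv.coe_coe]
    rw [LinearMap.quotKerEquivRange_symm_apply_image]
    simp
  let f1 : LinearMap.range L →L[ℝ] ℝ := f0.mkContinuous 1 (by
    rintro ⟨_, a, rfl⟩
    rw [hf0, one_mul]
    exact hle' a)
  obtain ⟨f, hf, hfn⟩ := _root_.exists_extension_norm_eq (𝕜 := ℝ) (LinearMap.range L) f1
  refine ⟨f, ?_, fun n => ?_⟩
  · rw [hfn]; exact LinearMap.mkContinuous_norm_le _ zero_le_one _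
  · have h1 : L (Finsupp.single n 1) = x n := by simp [L]
    have h2 : l (Finsupp.single n 1) = u n := by simp [l]
    rw [← h2, ← hf0, ← h1]
    exact hf ⟨L (Finsupp.single n 1), LinearMap.mem_range_self L _⟩

lemma aux_density {S X : Type*} [MeasurableSpace S] [NormedAddCommGroup X] [NormedSpace ℝ X]
    (P : Measure S) [IsProbabilityMeasure P] (Γ : Lp X 1 P →L[ℝ] ℝ) (g : S → X)
    (hg : StronglyMeasurable g) (R : ℝ) (hR : ∀ s, ‖g s‖ ≤ R) :
    ∃ u : S → ℝ, StronglyMeasurable u ∧ Integrable u P ∧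
      ∀ (v : S → ℝ), MemLp v 2 P → ∀ (hi : Integrable (fun s => v s • g s) P),
        Γ (hi.toL1 _) = ∫ s, v s * u s ∂P := by
  have hg2 : MemLp g 2 P := MemLp.of_bound hg.aestronglyMeasurable R (ae_of_all _ hR)
  let T : Lp ℝ 2 P →L[ℝ] Lp X 1 P :=
    (((ContinuousLinearMap.lsmul ℝ ℝ : ℝ →L[ℝ] X →L[ℝ] X).holderL P 2 2 1).flip (hg2.toLp g))
  let U : Lp ℝ 2 P := (InnerProductSpace.toDual ℝ (Lp ℝ 2 P)).symm (Γ.comp T)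
  refine ⟨U, Lp.stronglyMeasurable U, (Lp.memLp U).integrable (by norm_num), ?_⟩
  intro v hv hi
  have h1 : hi.toL1 _ = T (hv.toLp v) := by
    apply Lp.ext
    have h2 : T (hv.toLp v) = (ContinuousLinearMap.lsmul ℝ ℝ : ℝ →L[ℝ] X →L[ℝ] X).holder 1
      (hv.toLp v) (hg2.toLp g) := rfl
    rw [h2]
    filter_upwards [hi.coeFn_toL1, ContinuousLinearMap.coeFn_holder (r := 1)
      (ContinuousLinearMap.lsmul ℝ ℝ : ℝ →L[ℝ] X →L[ℝ] X) (hv.toLp v) (hg2.toLp g),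
      hv.coeFn_toLp, hg2.coeFn_toLp] with s a1 a2 a3 a4
    rw [a1, a2, a3, a4]
    simp
  have h3 : inner ℝ U (hv.toLp v) = (Γ.comp T) (hv.toLp v) :=
    InnerProductSpace.toDual_symm_apply
  rw [h1, ← ContinuousLinearMap.comp_apply, ← h3, L2.inner_def]
  refine integral_congr_ae ?_
  filter_upwards [hv.coeFn_toLp] with s a1
  rw [a1]; simp

lemma aux_fiber {X Δ : Type*} [NormedAddCommGroup X] [NormedSpace ℝ X] [MeasurableSpace Δ]
    (ν : Measure Δ) [IsProbabilityMeasure ν]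
    (r : ℕ → Δ → ℝ) (hr : ∀ n, Measurable (r n)) (hr1 : ∀ n t, r n t * r n t = 1)
    (horth : ∀ n m, n ≠ m → ∫ t, r n t * r m t ∂ν = 0)
    (ε : ℝ) (M : Set X) (hM : IsWeaklyPrecompactWith ε M) (R : ℝ)
    (hR : ∀ x ∈ M, ‖x‖ ≤ R) (x : ℕ → X) (hx : ∀ n, x n ∈ M) (u : ℕ → Δ → ℝ)
    (hu : ∀ n, Measurable (u n))
    (hf : ∀ᵐ t ∂ν, ∃ f : X →L[ℝ] ℝ, ‖f‖ ≤ 1 ∧ ∀ n, f (x n) = u n t) (c : ℝ) (hc : ε < c) :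
    ∀ᶠ n in atTop, ∫ t, r n t * u n t ∂ν < c := by
  have hR0 : 0 ≤ R := (norm_nonneg _).trans (hR _ (hx 0))
  have hrb : ∀ n t, |r n t| = 1 := by
    intro n t
    rcases mul_self_eq_one_iff.mp (hr1 n t) with h | h <;> simp [h]
  by_contra hcon
  rw [Filter.not_eventually] at hcon
  simp only [not_lt] at hcon
  obtain ⟨ψ, hψ, hψc⟩ := Filter.extraction_of_frequently_atTop hcon
  obtain ⟨θ, hθ, hδ⟩ := hM.2 (fun k => x (ψ k)) (fun k => hx _)
  have hmono : StrictMono (fun k => ψ (θ k)) := hψ.comp hθ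
  let y : ℕ → Δ → ℝ := fun k t => u (ψ (θ k)) t
  have hy : ∀ k, Measurable (y k) := fun k => hu _
  let w : Δ → ℝ := fun t => limsup (fun k => y k t) atTop
  have hw : Measurable w := Measurable.limsup hy
  have hae : ∀ᵐ t ∂ν, (∀ k, |y k t| ≤ R) ∧ |w t| ≤ R ∧
      ∀ e > ε, ∀ᶠ k in atTop, |y k t - w t| < e := by
    filter_upwards [hf] with t ⟨f, hf1, hft⟩
    have hyR : ∀ k, |y k t| ≤ R := by
      intro k
      simp only [y]
      rw [← hft, ← Real.norm_eq_abs]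
      calc ‖f (x (ψ (θ k)))‖ ≤ ‖f‖ * ‖x (ψ (θ k))‖ := f.le_opNorm _
        _ ≤ 1 * R := mul_le_mul hf1 (hR _ (hx _)) (norm_nonneg _) zero_le_one
        _ = R := one_mul R
    have hba : IsBoundedUnder (· ≤ ·) atTop (fun k => y k t) :=
      isBoundedUnder_of ⟨R, fun k => (abs_le.mp (hyR k)).2⟩
    have hbb : IsBoundedUnder (· ≥ ·) atTop (fun k => y k t) :=
      isBoundedUnder_of ⟨-R, fun k => (abs_le.mp (hyR k)).1⟩
    have hosc : limsup (fun k => y k t) atTop - liminf (fun k => y k t) atTop ≤ ε := by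
      have := hδ f hf1
      simpa only [hft] using this
    have hll : liminf (fun k => y k t) atTop ≤ limsup (fun k => y k t) atTop :=
      liminf_le_limsup hba hbb
    refine ⟨hyR, ?_, ?_⟩
    · rw [abs_le]
      constructor
      · refine le_trans ?_ hll
        exact le_liminf_of_le hba.isCoboundedUnder_ge
          (Eventually.of_forall fun k => (abs_le.mp (hyR k)).1)
      · exact limsup_le_of_le hbb.isCoboundedUnder_le
          (Eventually.of_forall fun k => (abs_le.mp (hyR k)).2)
    · intro e he
      have h1 : ∀ᶠ k in atTop, y k t < w t + e :=
        eventually_lt_of_limsup_lt (by simp only [w]; linarith) hba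
      have h2 : ∀ᶠ k in atTop, w t - e < y k t :=
        eventually_lt_of_lt_liminf (by simp only [w]; linarith) hbb
      filter_upwards [h1, h2] with k h1 h2
      rw [abs_lt]; constructor <;> linarith
  have hwm : MemLp w 2 ν := MemLp.of_bound hw.aestronglyMeasurable R
    (hae.mono fun t ht => ht.2.1)
  have hwi : Integrable w ν := hwm.integrable (by norm_num)
  have hyi : ∀ k, Integrable (y k) ν := fun k =>
    Integrable.of_bound (hy k).aestronglyMeasurable R (hae.mono fun t ht => ht.1 k)
  have hnull := (aux_weaklyNull ν r hr hr1 horth w hwm).comp hmono.tendsto_atTop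
  have hdom : Tendsto (fun k => ∫ t, max (|y k t - w t|) ε ∂ν) atTop (𝓝 (∫ _, ε ∂ν)) := by
    refine tendsto_integral_of_dominated_convergence (fun _ => 2 * R + |ε|) ?_ ?_ ?_ ?_
    · intro k
      exact (((hy k).sub hw).abs.max measurable_const).aestronglyMeasurable
    · exact integrable_const _
    · intro k
      filter_upwards [hae] with t ht
      have h1 := ht.1 k
      have h2 := ht.2.1
      have h3 : |y k t - w t| ≤ 2 * R := (abs_sub _ _).trans (by linarith)
      rw [Real.norm_eq_abs, abs_le]
      constructor
      · have := le_max_left (|y k t - w t|) ε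
        linarith [abs_nonneg (y k t - w t), abs_nonneg ε]
      · exact max_le (by linarith [abs_nonneg ε]) (by linarith [le_abs_self ε])
    · filter_upwards [hae] with t ht
      rw [Metric.tendsto_nhds]
      intro e he
      filter_upwards [ht.2.2 (ε + e) (by linarith)] with k hk
      rw [Real.dist_eq, abs_of_nonneg (by linarith [le_max_right (|y k t - w t|) ε])]
      rcases max_cases (|y k t - w t|) ε with h | h <;> linarith [h.1]
  rw [integral_const, probReal_univ, one_smul] at hdom
  have hsum := hdom.add hnull
  rw [add_zero] at hsum
  have hge : ∀ k, c ≤ (∫ t, max (|y k t - w t|) ε ∂ν) +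
      ((fun n => ∫ t, r n t * w t ∂ν) ∘ fun k => ψ (θ k)) k := by
    intro k
    have hbr : ∀ z : Δ → ℝ, Integrable z ν → Integrable (fun t => r (ψ (θ k)) t * z t) ν := by
      intro z hz
      exact hz.bdd_mul (c := 1) (hr _).aestronglyMeasurable
        (ae_of_all _ fun t => by rw [Real.norm_eq_abs, hrb])
    have h0 := hψc (θ k)
    have h1 : ∫ t, r (ψ (θ k)) t * y k t ∂ν = ∫ t, r (ψ (θ k)) t * (y k t - w t) ∂ν +
        ∫ t, r (ψ (θ k)) t * w t ∂ν := by
      have e := integral_add (hbr (fun t => y k t - w t) ((hyi k).sub hwi)) (hbr w hwi)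
      rw [← e]
      congr 1; ext t; ring
    have h2 : ∫ t, r (ψ (θ k)) t * (y k t - w t) ∂ν ≤ ∫ t, max (|y k t - w t|) ε ∂ν := by
      refine integral_mono (hbr _ ((hyi k).sub hwi))
        (((hyi k).sub hwi).abs.sup (integrable_const ε)) ?_
      intro t
      refine le_trans ?_ (le_max_left _ _)
      calc r (ψ (θ k)) t * (y k t - w t) ≤ |r (ψ (θ k)) t * (y k t - w t)| := le_abs_self _
        _ = |y k t - w t| := by rw [abs_mul, hrb, one_mul]
    simp only [Function.comp]
    linarith [h0, h1, h2]
  have := ge_of_tendsto' hsum hge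
  linarith

noncomputable def auxCoin : Measure Bool := (PMF.uniformOfFintype Bool).toMeasure

instance : IsProbabilityMeasure auxCoin := by unfold auxCoin; infer_instance

noncomputable def auxHaar : Measure (ℕ → Bool) := Measure.infinitePi (fun _ : ℕ => auxCoin)

instance : IsProbabilityMeasure auxHaar := by unfold auxHaar; infer_instance

noncomputable def auxSign (b : Bool) : ℝ := if b then 1 else -1

noncomputable def auxRad (n : ℕ) (t : ℕ → Bool) : ℝ := auxSign (t n)

lemma auxRad_measurable (n : ℕ) : Measurable (auxRad n) :=
  (measurable_of_finite auxSign).comp (measurable_pi_apply n)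

lemma auxSign_mul_self (b : Bool) : auxSign b * auxSign b = 1 := by
  cases b <;> simp [auxSign]

lemma auxSign_integral : ∫ b, auxSign b ∂auxCoin = 0 := by
  unfold auxCoin
  rw [PMF.integral_eq_sum]
  simp [auxSign]

lemma auxRad_integral (n : ℕ) : ∫ t, auxRad n t ∂auxHaar = 0 := by
  have h := measurePreserving_eval_infinitePi (fun _ : ℕ => auxCoin) n
  have h3 := integral_map (μ := auxHaar) (φ := fun t : ℕ → Bool => t n) (measurable_pi_apply n).aemeasurable (f := auxSign) (measurable_of_finite _).aestronglyMeasurable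
  rw [show Measure.map (fun t : ℕ → Bool => t n) auxHaar = auxCoin from h.map_eq, auxSign_integral] at h3
  exact h3.symm

lemma auxRad_orth (n m : ℕ) (hnm : n ≠ m) : ∫ t, auxRad n t * auxRad m t ∂auxHaar = 0 := by
  have hI : ProbabilityTheory.iIndepFun auxRad auxHaar :=
    ProbabilityTheory.iIndepFun_infinitePi (P := fun _ : ℕ => auxCoin) (X := fun _ => auxSign)
      (fun _ => measurable_of_finite _)
  rw [(hI.indepFun hnm).integral_fun_mul_eq_mul_integral
    (auxRad_measurable n).aestronglyMeasurable (auxRad_measurable m).aestronglyMeasurable,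
    auxRad_integral, zero_mul]

lemma aux_sep {E : Type*} [NormedAddCommGroup E] [NormedSpace ℝ E] (S : Set E)
    (hS : Convex ℝ S) (c : ℝ) (hc : 0 < c) (h : ∀ z ∈ S, c ≤ ‖z‖) :
    ∃ Γ : E →L[ℝ] ℝ, ‖Γ‖ ≤ 1 ∧ ∀ z ∈ S, c ≤ Γ z := by
  obtain ⟨f, u, h1, h2⟩ := geometric_hahn_banach_open (convex_ball (0 : E) c) Metric.isOpen_ball hS
    (by
      rw [Set.disjoint_left]
      intro z hz hzS
      rw [mem_ball_zero_iff] at hz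
      linarith [h z hzS])
  have hu : 0 < u := by
    have := h1 0 (Metric.mem_ball_self hc)
    simpa using this
  have key : ∀ x, f x * c ≤ u * ‖x‖ := by
    intro x
    by_contra hcon
    rw [not_le] at hcon
    have hpos : 0 < f x := by
      by_contra hn
      have : f x * c ≤ 0 := mul_nonpos_of_nonpos_of_nonneg (not_lt.mp hn) hc.le
      have : 0 ≤ u * ‖x‖ := by positivity
      linarith
    have := h1 ((u / f x) • x) (by
      rw [mem_ball_zero_iff, norm_smul, Real.norm_eq_abs, abs_of_pos (by positivity),
        div_mul_eq_mul_div, div_lt_iff₀ hpos]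
      linarith)
    rw [map_smul, smul_eq_mul, div_mul_cancel₀ _ hpos.ne'] at this
    exact lt_irrefl _ this
  refine ⟨(c / u) • f, ?_, ?_⟩
  · refine ContinuousLinearMap.opNorm_le_bound _ zero_le_one ?_
    intro x
    have k1 := key x
    have k2 := key (-x)
    rw [norm_neg, map_neg] at k2
    simp only [_root_.smul_apply, smul_eq_mul, Real.norm_eq_abs]
    rw [one_mul, div_mul_eq_mul_div, abs_div, abs_of_pos hu, div_le_iff₀ hu, abs_le]
    constructor <;> linarith
  · intro z hz
    simp only [_root_.smul_apply, smul_eq_mul]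
    rw [div_mul_eq_mul_div, le_div_iff₀ hu]
    exact mul_le_mul_of_nonneg_left (h2 z hz) hc.le

lemma aux_sum_coe {Ω X ι : Type*} [MeasurableSpace Ω] [NormedAddCommGroup X] [NormedSpace ℝ X]
    (μ : Measure Ω) (s : Finset ι) (c : ι → ℝ) (h : ι → Ω → X) (hi : ∀ i, Integrable (h i) μ) :
    (∑ i ∈ s, c i • (hi i).toL1 (h i) : Lp X 1 μ) =ᵐ[μ] fun ω => ∑ i ∈ s, c i • h i ω := by
  classical
  induction s using Finset.induction_on with
  | empty =>
    simp only [Finset.sum_empty]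
    exact Lp.coeFn_zero X 1 μ
  | insert i s his ih =>
    rw [Finset.sum_insert his]
    filter_upwards [ih, Lp.coeFn_add (c i • (hi i).toL1 (h i))
      (∑ i ∈ s, c i • (hi i).toL1 (h i) : Lp X 1 μ), Lp.coeFn_smul (c i) ((hi i).toL1 (h i)),
      (hi i).coeFn_toL1] with ω h1 h2 h3 h4
    rw [h2, Pi.add_apply, h1, h3, Pi.smul_apply, h4, Finset.sum_insert his]

lemma aux_sum_norm {Ω X ι : Type*} [MeasurableSpace Ω] [NormedAddCommGroup X] [NormedSpace ℝ X]
    (μ : Measure Ω) (s : Finset ι) (c : ι → ℝ) (h : ι → Ω → X) (hi : ∀ i, Integrable (h i) μ) :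
    ‖(∑ i ∈ s, c i • (hi i).toL1 (h i) : Lp X 1 μ)‖ = ∫ ω, ‖∑ i ∈ s, c i • h i ω‖ ∂μ := by
  rw [L1.norm_eq_integral_norm]
  refine integral_congr_ae ?_
  filter_upwards [aux_sum_coe μ s c h hi] with ω hω
  rw [hω]

lemma auxSign_abs (b : Bool) : |auxSign b| = 1 := by
  cases b <;> simp [auxSign]

lemma aux_gamma {Ω X : Type*} [MeasurableSpace Ω] [NormedAddCommGroup X] [NormedSpace ℝ X]
    (μ : Measure Ω) [IsProbabilityMeasure μ] (g : ℕ → Ω → X)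
    (hgi : ∀ n, Integrable (g n) μ) (a b : ℝ) (hab : a < b)
    (hpat : ∀ (N : ℕ) (t : ℕ → Bool), ∃ G : Lp X 1 μ →L[ℝ] ℝ, ‖G‖ ≤ 1 ∧ ∀ n < N,
      (t n = true → b < G ((hgi n).toL1 (g n))) ∧ (t n = false → G ((hgi n).toL1 (g n)) < a))
    (hzi : ∀ n, Integrable (fun p : Ω × (ℕ → Bool) => auxRad n p.2 • g n p.1)
      (μ.prod auxHaar)) :
    ∃ Γ : Lp X 1 (μ.prod auxHaar) →L[ℝ] ℝ, ‖Γ‖ ≤ 1 ∧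
      ∀ n, (b - a) / 2 ≤ Γ ((hzi n).toL1 _) := by
  obtain ⟨Γ, h1, h2⟩ := aux_sep (convexHull ℝ (Set.range fun n => (hzi n).toL1 _))
    (convex_convexHull ℝ _) ((b - a) / 2) (by linarith) (by
      intro z hz
      rw [mem_convexHull_iff_exists_fintype] at hz
      obtain ⟨ι, _, w, y, hw0, hw1, hy, rfl⟩ := hz
      choose k hk using hy
      have e1 : ∑ i, w i • y i = ∑ i, w i • (hzi (k i)).toL1 _ := by
        refine Finset.sum_congr rfl fun i _ => ?_
        rw [← hk i]
      rw [e1, aux_sum_norm (μ.prod auxHaar) Finset.univ w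
        (fun i (p : Ω × (ℕ → Bool)) => auxRad (k i) p.2 • g (k i) p.1) (fun i => hzi (k i))]
      have hFi : Integrable (fun p : Ω × (ℕ → Bool) =>
          ‖∑ i, w i • auxRad (k i) p.2 • g (k i) p.1‖) (μ.prod auxHaar) := by
        refine Integrable.norm ?_
        exact integrable_finsetSum _ fun i _ => (hzi (k i)).smul (w i)
      rw [integral_prod_symm _ hFi]
      have hri : ∀ n, Integrable (auxRad n) auxHaar := fun n =>
        Integrable.of_bound (auxRad_measurable n).aestronglyMeasurable 1
          (ae_of_all _ fun t => by rw [Real.norm_eq_abs]; exact (auxSign_abs _).le)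
      have hlow : ∀ t : ℕ → Bool, ∑ i, (w i * ((b - a) / 2) + (w i * ((a + b) / 2)) * auxRad (k i) t)
          ≤ ∫ ω, ‖∑ i, w i • auxRad (k i) t • g (k i) ω‖ ∂μ := by
        intro t
        obtain ⟨G, hG1, hG2⟩ := hpat (Finset.univ.sup k + 1) t
        have e2 : ∫ ω, ‖∑ i, w i • auxRad (k i) t • g (k i) ω‖ ∂μ =
            ‖(∑ i, (w i * auxRad (k i) t) • (hgi (k i)).toL1 (g (k i)) : Lp X 1 μ)‖ := by
          rw [aux_sum_norm μ Finset.univ (fun i => w i * auxRad (k i) t)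
            (fun i => g (k i)) (fun i => hgi (k i))]
          simp only [mul_smul]
        rw [e2]
        set Y : Lp X 1 μ := ∑ i, (w i * auxRad (k i) t) • (hgi (k i)).toL1 (g (k i)) with hY
        have h3 : G Y ≤ ‖Y‖ := by
          calc G Y ≤ ‖G Y‖ := Real.le_norm_self _
            _ ≤ ‖G‖ * ‖Y‖ := G.le_opNorm Y
            _ ≤ 1 * ‖Y‖ := mul_le_mul_of_nonneg_right hG1 (norm_nonneg _)
            _ = ‖Y‖ := one_mul _
        refine le_trans ?_ h3
        rw [hY, map_sum]
        refine Finset.sum_le_sum fun i _ => ?_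
        rw [map_smul, smul_eq_mul]
        have hi := hG2 (k i) (Nat.lt_succ_of_le (Finset.le_sup (f := k) (Finset.mem_univ i)))
        have hwi := hw0 i
        cases hti : t (k i) with
        | true =>
          have h4 := hi.1 hti
          have h5 : auxRad (k i) t = 1 := by simp [auxRad, auxSign, hti]
          rw [h5]
          nlinarith
        | false =>
          have h4 := hi.2 hti
          have h5 : auxRad (k i) t = -1 := by simp [auxRad, auxSign, hti]
          rw [h5]
          nlinarith
      have hintg : ∀ i, Integrable (fun t => w i * ((b - a) / 2) +
          (w i * ((a + b) / 2)) * auxRad (k i) t) auxHaar := fun i =>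
        (integrable_const _).add ((hri _).const_mul _)
      have e3 : ∫ t, ∑ i, (w i * ((b - a) / 2) + (w i * ((a + b) / 2)) * auxRad (k i) t) ∂auxHaar
          = (b - a) / 2 := by
        rw [integral_finsetSum _ fun i _ => hintg i]
        have : ∀ i, ∫ t, (w i * ((b - a) / 2) + (w i * ((a + b) / 2)) * auxRad (k i) t) ∂auxHaar
            = w i * ((b - a) / 2) := by
          intro i
          rw [integral_add (integrable_const _) ((hri _).const_mul _), integral_const_mul (w i * ((a + b) / 2)),
            auxRad_integral]
          simp
        simp only [this]
        rw [← Finset.sum_mul, hw1, one_mul]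
      rw [← e3]
      exact integral_mono (integrable_finsetSum _ fun i _ => hintg i)
        hFi.integral_prod_right hlow)
  exact ⟨Γ, h1, fun n => h2 _ (subset_convexHull ℝ _ ⟨n, rfl⟩)⟩

lemma aux_main {Ω X : Type*} [MeasurableSpace Ω] [NormedAddCommGroup X] [NormedSpace ℝ X]
    (μ : Measure Ω) [IsProbabilityMeasure μ] (ε : ℝ) (M : Set X)
    (hM : IsWeaklyPrecompactWith ε M) (g : ℕ → Ω → X) (hgm : ∀ n, StronglyMeasurable (g n))
    (hgM : ∀ n ω, g n ω ∈ M)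
    (hgi : ∀ n, Integrable (g n) μ) (a b : ℝ) (hε : 0 ≤ ε) (hab : 2 * ε < b - a)
    (hpat : ∀ (N : ℕ) (t : ℕ → Bool), ∃ G : Lp X 1 μ →L[ℝ] ℝ, ‖G‖ ≤ 1 ∧ ∀ n < N,
      (t n = true → b < G ((hgi n).toL1 (g n))) ∧ (t n = false → G ((hgi n).toL1 (g n)) < a)) :
    False := by
  obtain ⟨R, hR⟩ := hM.1.exists_norm_le
  have hgR : ∀ n ω, ‖g n ω‖ ≤ R := fun n ω => hR _ (hgM n ω)
  set P := μ.prod auxHaar with hP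
  let h : ℕ → Ω × (ℕ → Bool) → X := fun n p => g n p.1
  have hhm : ∀ n, StronglyMeasurable (h n) := fun n => (hgm n).comp_measurable measurable_fst
  have hhR : ∀ n p, ‖h n p‖ ≤ R := fun n p => hgR n p.1
  let r : ℕ → Ω × (ℕ → Bool) → ℝ := fun n p => auxRad n p.2
  have hrm : ∀ n, Measurable (r n) := fun n => (auxRad_measurable n).comp measurable_snd
  have hr1 : ∀ n p, |r n p| = 1 := fun n p => auxSign_abs _
  have hhi : ∀ n, Integrable (h n) P := fun n =>
    Integrable.of_bound (hhm n).aestronglyMeasurable R (ae_of_all _ (hhR n))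
  have hvi : ∀ (v : Ω × (ℕ → Bool) → ℝ) n, Measurable v → (∀ p, |v p| ≤ 1) →
      Integrable (fun p => v p • h n p) P := by
    intro v n hv hv1
    refine Integrable.of_bound (hv.stronglyMeasurable.smul (hhm n)).aestronglyMeasurable R
      (ae_of_all _ fun p => ?_)
    rw [norm_smul, Real.norm_eq_abs]
    calc |v p| * ‖h n p‖ ≤ 1 * R := mul_le_mul (hv1 p) (hhR n p) (norm_nonneg _) zero_le_one
      _ = R := one_mul R
  have hv2 : ∀ (v : Ω × (ℕ → Bool) → ℝ), Measurable v → (∀ p, |v p| ≤ 1) → MemLp v 2 P := by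
    intro v hv hv1
    exact MemLp.of_bound hv.aestronglyMeasurable 1 (ae_of_all _ hv1)
  have hzi : ∀ n, Integrable (fun p : Ω × (ℕ → Bool) => auxRad n p.2 • g n p.1) P :=
    fun n => hvi (r n) n (hrm n) (fun p => (hr1 n p).le)
  obtain ⟨Γ, hΓ1, hΓ⟩ := aux_gamma μ g hgi a b (by linarith) hpat hzi
  choose u hum hui hu using fun n => aux_density P Γ (h n) (hhm n) R (hhR n)
  have hlow : ∀ n, (b - a) / 2 ≤ ∫ p, r n p * u n p ∂P := by
    intro n
    rw [← hu n (r n) (hv2 _ (hrm n) (fun p => (hr1 n p).le)) (hzi n)]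
    exact hΓ n
  -- domination by the norm
  have hdom : ∀ (m : ℕ) (c : Fin m → ℚ), ∀ᵐ p ∂P,
      ∑ i, (c i : ℝ) * u i p ≤ ‖∑ i, (c i : ℝ) • h i p‖ := by
    intro m c
    have i1 : Integrable (fun p => ∑ i, (c i : ℝ) * u i p) P :=
      integrable_finsetSum _ fun i _ => (hui i).const_mul _
    have i2 : Integrable (fun p => ∑ i, (c i : ℝ) • h i p) P :=
      integrable_finsetSum _ fun i _ => (hhi i).smul _
    refine ae_le_of_forall_setIntegral_le i1 i2.norm ?_
    intro A hA _
    let v : Ω × (ℕ → Bool) → ℝ := A.indicator fun _ => 1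
    have hvm : Measurable v := measurable_const.indicator hA
    have hv1 : ∀ p, |v p| ≤ 1 := by
      intro p
      by_cases hp : p ∈ A <;> simp [v, hp]
    have e1 : ∀ i : Fin m, ∫ p, v p * u i p ∂P = Γ ((hvi v i hvm hv1).toL1 _) := fun i =>
      (hu i v (hv2 v hvm hv1) (hvi v i hvm hv1)).symm
    have e2 : ∀ (i : Fin m), ∫ p, v p * u i p ∂P = ∫ p in A, u i p ∂P := by
      intro i
      rw [← integral_indicator hA]
      congr 1; ext p
      by_cases hp : p ∈ A <;> simp [v, hp]
    rw [integral_finsetSum _ fun (i : Fin m) _ => ((hui i).const_mul (c i : ℝ)).integrableOn]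
    have e3 : ∑ i, ∫ p in A, (c i : ℝ) * u i p ∂P =
        Γ (∑ i, (c i : ℝ) • (hvi v i hvm hv1).toL1 _) := by
      rw [map_sum]
      refine Finset.sum_congr rfl fun i _ => ?_
      rw [map_smul, ← e1, e2, smul_eq_mul, integral_const_mul]
    rw [e3]
    calc Γ (∑ i, (c i : ℝ) • (hvi v i hvm hv1).toL1 _) ≤ _ := Real.le_norm_self _
      _ ≤ ‖Γ‖ * _ := Γ.le_opNorm _
      _ ≤ 1 * _ := mul_le_mul_of_nonneg_right hΓ1 (norm_nonneg _)
      _ = ∫ p, ‖∑ i, (c i : ℝ) • v p • h i p‖ ∂P := by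
        rw [one_mul]
        exact aux_sum_norm P Finset.univ (fun i => (c i : ℝ)) (fun (i : Fin m) p => v p • h i p)
          (fun i => hvi v i hvm hv1)
      _ = ∫ p in A, ‖∑ i, (c i : ℝ) • h i p‖ ∂P := by
        rw [← integral_indicator hA]
        congr 1; ext p
        by_cases hp : p ∈ A <;> simp [v, hp]
  have hdom2 : ∀ᵐ p ∂P, ∀ (m : ℕ) (c : Fin m → ℚ),
      ∑ i, (c i : ℝ) * u i p ≤ ‖∑ i, (c i : ℝ) • h i p‖ := by
    rw [ae_all_iff]; intro m
    rw [ae_all_iff]; exact hdom m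
  have hfun : ∀ᵐ ω ∂μ, ∀ᵐ t ∂auxHaar, ∃ f : X →L[ℝ] ℝ, ‖f‖ ≤ 1 ∧
      ∀ n, f (g n ω) = u n (ω, t) := by
    filter_upwards [Measure.ae_ae_of_ae_prod hdom2] with ω hω
    filter_upwards [hω] with t ht
    exact aux_helly (fun n => g n ω) (fun n => u n (ω, t)) ht
  let φ : ℕ → Ω → ℝ := fun n ω => ∫ t, auxRad n t * u n (ω, t) ∂auxHaar
  have hrui : ∀ n, Integrable (fun p => r n p * u n p) P := fun n =>
    (hui n).bdd_mul (c := 1) (hrm n).aestronglyMeasurable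
      (ae_of_all _ fun p => by rw [Real.norm_eq_abs, hr1])
  have hφi : ∀ n, Integrable (φ n) μ := fun n => (hrui n).integral_prod_left
  have hφlow : ∀ n, (b - a) / 2 ≤ ∫ ω, φ n ω ∂μ := by
    intro n
    have := integral_prod _ (hrui n)
    rw [← this]
    exact hlow n
  have hφR : ∀ᵐ ω ∂μ, ∀ n, |φ n ω| ≤ R := by
    filter_upwards [hfun] with ω hω n
    have : ‖φ n ω‖ ≤ R * auxHaar.real Set.univ := by
      refine norm_integral_le_of_norm_le_const ?_
      filter_upwards [hω] with t ⟨f, hf1, hf⟩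
      rw [norm_mul, Real.norm_eq_abs, auxRad, auxSign_abs, one_mul, ← hf]
      calc ‖f (g n ω)‖ ≤ ‖f‖ * ‖g n ω‖ := f.le_opNorm _
        _ ≤ 1 * R := mul_le_mul hf1 (hgR n ω) (norm_nonneg _) zero_le_one
        _ = R := one_mul R
    simpa using this
  have hconv : Tendsto (fun n => ∫ ω, max (φ n ω) ε ∂μ) atTop (𝓝 (∫ _, ε ∂μ)) := by
    refine tendsto_integral_of_dominated_convergence (fun _ => R + ε) ?_ (integrable_const _) ?_ ?_
    · intro n
      exact ((hφi n).sup (integrable_const ε)).aestronglyMeasurable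
    · intro n
      filter_upwards [hφR] with ω hω
      have h1 := abs_le.mp (hω n)
      rw [Real.norm_eq_abs, abs_of_nonneg (hε.trans (le_max_right _ _))]
      exact max_le (by linarith) (by linarith [abs_nonneg (φ n ω), hω n])
    · filter_upwards [hfun] with ω hω
      rw [Metric.tendsto_nhds]
      intro e he
      have := aux_fiber auxHaar auxRad auxRad_measurable (fun n t => auxSign_mul_self _)
        auxRad_orth ε M hM R hR (fun n => g n ω) (fun n => hgM n ω) (fun n t => u n (ω, t))
        (fun n => (hum n).measurable.comp measurable_prodMk_left) hω (ε + e) (by linarith)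
      filter_upwards [this] with n hn
      rw [Real.dist_eq, abs_of_nonneg (by linarith [le_max_right (φ n ω) ε])]
      have hn' : φ n ω < ε + e := hn
      rcases max_cases (φ n ω) ε with h | h <;> linarith [h.1]
  rw [integral_const, probReal_univ, one_smul] at hconv
  have := ge_of_tendsto' hconv (fun n => (hφlow n).trans (integral_mono (hφi n)
    ((hφi n).sup (integrable_const ε)) (fun ω => le_max_left _ _)))
  linarith

lemma aux_insert_zero {X : Type*} [NormedAddCommGroup X] [NormedSpace ℝ X] (ε : ℝ) (hε : 0 ≤ ε)
    (M : Set X) (hM : IsWeaklyPrecompactWith ε M) : IsWeaklyPrecompactWith ε (insert 0 M) := by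
  refine ⟨hM.1.insert 0, fun x hx => ?_⟩
  by_cases hfr : ∃ᶠ n in atTop, x n ∈ M
  · obtain ⟨ψ, hψ, hψM⟩ := Filter.extraction_of_frequently_atTop hfr
    obtain ⟨θ, hθ, hδ⟩ := hM.2 (fun k => x (ψ k)) hψM
    exact ⟨fun k => ψ (θ k), hψ.comp hθ, hδ⟩
  · rw [Filter.not_frequently, eventually_atTop] at hfr
    obtain ⟨m, hm⟩ := hfr
    refine ⟨fun k => k + m, fun i j hij => Nat.add_lt_add_right hij m, fun f _ => ?_⟩
    have h0 : ∀ k, x (k + m) = 0 := fun k =>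
      (hx (k + m)).resolve_right (hm _ (Nat.le_add_left _ _))
    simp only [h0, map_zero, limsup_const, liminf_const, sub_self]
    exact hε

lemma OscOn.mono {E : Type*} [NormedAddCommGroup E] [NormedSpace ℝ E] {S T : Set ℕ} {x : ℕ → E}
    {c : ℝ} (hS : OscOn S x c) (hTS : T ⊆ S) : OscOn T x c := by
  intro f hf a b hab h
  exact hS f hf a b hab ⟨h.1.mono fun n hn => ⟨hTS hn.1, hn.2⟩,
    h.2.mono fun n hn => ⟨hTS hn.1, hn.2⟩⟩

lemma aux_deltaLE {E : Type*} [NormedAddCommGroup E] [NormedSpace ℝ E] (x : ℕ → E) (R : ℝ)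
    (hR : ∀ n, ‖x n‖ ≤ R) (N : Set ℕ) (hN : N.Infinite) (c : ℝ) (hosc : OscOn N x c) :
    DeltaLE (fun k => x (Nat.nth (· ∈ N) k)) c := by
  intro f hf
  by_contra hcon
  rw [not_le] at hcon
  have hinj : Function.Injective (Nat.nth (· ∈ N)) := (Nat.nth_strictMono hN).injective
  have hmem : ∀ k, Nat.nth (· ∈ N) k ∈ N := fun k => Nat.nth_mem_of_infinite hN k
  set y : ℕ → ℝ := fun k => f (x (Nat.nth (· ∈ N) k)) with hy
  have hyR : ∀ k, |y k| ≤ R := by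
    intro k
    rw [← Real.norm_eq_abs]
    calc ‖y k‖ ≤ ‖f‖ * ‖x (Nat.nth (· ∈ N) k)‖ := f.le_opNorm _
      _ ≤ 1 * R := mul_le_mul hf (hR _) (norm_nonneg _) zero_le_one
      _ = R := one_mul R
  have hba : IsBoundedUnder (· ≤ ·) atTop y :=
    isBoundedUnder_of ⟨R, fun k => (abs_le.mp (hyR k)).2⟩
  have hbb : IsBoundedUnder (· ≥ ·) atTop y :=
    isBoundedUnder_of ⟨-R, fun k => (abs_le.mp (hyR k)).1⟩
  set d := limsup y atTop - liminf y atTop - c with hd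
  have h1 : ∃ᶠ k in atTop, limsup y atTop - d / 3 < y k :=
    frequently_lt_of_lt_limsup hbb.isCoboundedUnder_le (by linarith)
  have h2 : ∃ᶠ k in atTop, y k < liminf y atTop + d / 3 :=
    frequently_lt_of_liminf_lt hba.isCoboundedUnder_ge (by linarith)
  rw [Nat.frequently_atTop_iff_infinite] at h1 h2
  refine hosc f hf (liminf y atTop + d / 3) (limsup y atTop - d / 3) (by linarith) ⟨?_, ?_⟩
  · refine (h2.image hinj.injOn).mono ?_
    rintro _ ⟨k, hk, rfl⟩
    exact ⟨hmem k, hk⟩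
  · refine (h1.image hinj.injOn).mono ?_
    rintro _ ⟨k, hk, rfl⟩
    exact ⟨hmem k, hk⟩

lemma aux_trunc {Ω X : Type*} [MeasurableSpace Ω] [NormedAddCommGroup X] [NormedSpace ℝ X]
    (μ : Measure Ω) [IsProbabilityMeasure μ] (ε : ℝ) (hε : 0 ≤ ε)
    (W : Set (Lp X 1 μ)) (hW : IsDeltaCSet μ ε W) (f : ℕ → Lp X 1 μ) (hf : ∀ n, f n ∈ W)
    (L : Set ℕ) (hL : L.Infinite) (η : ℝ) (hη : 0 < η) :
    ∃ N, N ⊆ L ∧ N.Infinite ∧ OscOn N f (2 * ε + 2 * η) := by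
  obtain ⟨δ, hδ, hUI⟩ := hW.1.2 η hη
  obtain ⟨M, hM, hMA⟩ := hW.2 δ hδ
  have hM0 := aux_insert_zero ε hε M hM
  have hex : ∀ n, ∃ g : Ω → X, StronglyMeasurable g ∧ (∀ ω, g ω ∈ insert 0 M) ∧
      ∃ hg : Integrable g μ, ‖f n - hg.toL1 g‖ ≤ η := by
    intro n
    obtain ⟨A, hA, hμA, hAM⟩ := hMA (f n) (hf n)
    obtain ⟨s, hs, hsm, hsp⟩ := hAM.exists_measurable_mem
    have hB : MeasurableSet (A ∩ s) := hA.inter hsm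
    have hμB : μ (A ∩ s) = μ A := by
      refine measure_congr ?_
      filter_upwards [hs] with ω hω
      exact propext ⟨fun h => h.1, fun h => ⟨h, hω⟩⟩
    have hfi : Integrable (f n) μ := L1.integrable_coeFn (f n)
    have hgi : Integrable ((A ∩ s).indicator (f n)) μ := hfi.indicator hB
    refine ⟨(A ∩ s).indicator (f n), (Lp.stronglyMeasurable (f n)).indicator hB, ?_, hgi, ?_⟩
    · intro ω
      by_cases hω : ω ∈ A ∩ s
      · rw [Set.indicator_of_mem hω]
        exact Or.inr (hsp ω hω.2 hω.1)
      · rw [Set.indicator_of_notMem hω]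
        exact Or.inl rfl
    · have hle : μ (A ∩ s)ᶜ ≤ ENNReal.ofReal δ := by
        rw [prob_compl_eq_one_sub hB, hμB, tsub_le_iff_right]
        calc (1 : ENNReal) = ENNReal.ofReal (δ + (1 - δ)) := by simp
          _ ≤ ENNReal.ofReal δ + ENNReal.ofReal (1 - δ) := ENNReal.ofReal_add_le
          _ ≤ _ := by gcongr
      have := hUI (f n) (hf n) _ hB.compl hle
      rw [← integral_indicator hB.compl] at this
      rw [L1.norm_eq_integral_norm]
      refine le_trans (le_of_eq ?_) this
      refine integral_congr_ae ?_
      filter_upwards [Lp.coeFn_sub (f n) (hgi.toL1 _), hgi.coeFn_toL1] with ω h1 h2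
      rw [h1, Pi.sub_apply, h2]
      by_cases hω : ω ∈ A ∩ s
      · rw [Set.indicator_of_mem hω, Set.indicator_of_notMem (by simpa using hω)]
        simp
      · rw [Set.indicator_of_notMem hω, Set.indicator_of_mem (by simpa using hω)]
        simp
  choose g hgm hgM hgi hgη using hex
  have hinj : Function.Injective (Nat.nth (· ∈ L)) := (Nat.nth_strictMono hL).injective
  have hmem : ∀ k, Nat.nth (· ∈ L) k ∈ L := fun k => Nat.nth_mem_of_infinite hL k
  set e : ℕ → ℕ := Nat.nth (· ∈ L) with he
  have hN : ∃ N : Set ℕ, N.Infinite ∧ OscOn N (fun k => (hgi (e k)).toL1 (g (e k))) (2 * ε) := by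
    by_contra hcon
    obtain ⟨a, b, hab, φ, -, hpat⟩ := aux_rosenthal (fun k => (hgi (e k)).toL1 (g (e k))) (2 * ε)
      (fun N hN hO => hcon ⟨N, hN, hO⟩)
    exact aux_main μ ε (insert 0 M) hM0 (fun n => g (e (φ n))) (fun n => hgm _)
      (fun n => hgM _) (fun n => hgi _) a b hε hab hpat
  obtain ⟨N, hN, hO⟩ := hN
  refine ⟨e '' N, ?_, hN.image hinj.injOn, ?_⟩
  · rintro _ ⟨k, _, rfl⟩
    exact hmem k
  · intro Λ hΛ a b hab ⟨h1, h2⟩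
    have hclose : ∀ n, |Λ (f n) - Λ ((hgi n).toL1 (g n))| ≤ η := by
      intro n
      rw [← map_sub, ← Real.norm_eq_abs]
      calc ‖Λ (f n - (hgi n).toL1 (g n))‖ ≤ ‖Λ‖ * ‖f n - (hgi n).toL1 (g n)‖ := Λ.le_opNorm _
        _ ≤ 1 * η := mul_le_mul hΛ (hgη n) (norm_nonneg _) zero_le_one
        _ = η := one_mul η
    refine hO Λ hΛ (a + η) (b - η) (by linarith) ⟨?_, ?_⟩
    · refine Set.Infinite.of_image e (h1.mono ?_)
      rintro _ ⟨⟨k, hk, rfl⟩, hka⟩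
      refine ⟨k, ⟨hk, ?_⟩, rfl⟩
      have := abs_le.mp (hclose (e k))
      show Λ ((hgi (e k)).toL1 (g (e k))) < a + η
      linarith
    · refine Set.Infinite.of_image e (h2.mono ?_)
      rintro _ ⟨⟨k, hk, rfl⟩, hka⟩
      refine ⟨k, ⟨hk, ?_⟩, rfl⟩
      have := abs_le.mp (hclose (e k))
      show b - η < Λ ((hgi (e k)).toL1 (g (e k)))
      linarith

theorem deltaCSet_weaklyPrecompact
    {Ω X : Type*} [MeasurableSpace Ω] [NormedAddCommGroup X] [NormedSpace ℝ X]
    [CompleteSpace X]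
    (μ : Measure Ω) [IsProbabilityMeasure μ] (ε : ℝ) (hε : 0 ≤ ε)
    (W : Set (Lp X 1 μ)) (hW : IsDeltaCSet μ ε W) :
    IsWeaklyPrecompactWith (2 * ε) W := by
  refine ⟨hW.1.1, fun f hf => ?_⟩
  obtain ⟨N, -, hN, hQ⟩ := aux_diag
    (fun i S => OscOn S f (2 * ε + 2 * (1 / ((i : ℝ) + 1))))
    (fun i S T hTS _ hS => hS.mono hTS)
    (fun i S hS => aux_trunc μ ε hε W hW f hf S hS _ (by positivity))
    Set.univ Set.infinite_univ
  have hosc : OscOn N f (2 * ε) := by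
    intro Λ hΛ a b hab ⟨h1, h2⟩
    obtain ⟨i, hi⟩ := exists_nat_one_div_lt (show 0 < (b - a - 2 * ε) / 2 by linarith)
    obtain ⟨m, hm⟩ := hQ i
    refine hm Λ hΛ a b (by linarith) ⟨?_, ?_⟩
    · refine (aux_inter_Ici _ m h1).mono ?_
      rintro n ⟨⟨hn, hna⟩, hnm⟩
      exact ⟨⟨hn, hnm⟩, hna⟩
    · refine (aux_inter_Ici _ m h2).mono ?_
      rintro n ⟨⟨hn, hna⟩, hnm⟩
      exact ⟨⟨hn, hnm⟩, hna⟩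
  refine ⟨Nat.nth (· ∈ N), Nat.nth_strictMono hN, ?_⟩
  obtain ⟨R, hR⟩ := hW.1.1.exists_norm_le
  exact aux_deltaLE f R (fun n => hR _ (hf n)) N hN _ hosc
end

section
/- Let X be a real Banach space and Y ⊆ X a closed linear subspace not containing any subspace isomorphic to ℓ₁. Then X has property KM_w if and only if the quotient space X/Y has property KM_w. -/
open Filter Topology

/-- A Banach space `E` contains a subspace isomorphic to `ℓ₁` if some closed linear
subspace of `E` is isomorphic to `ℓ₁` via a continuous linear isomorphism. -/
def ContainsL1 (E : Type*) [NormedAddCommGroup E] [NormedSpace ℝ E] : Prop :=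
  ∃ Z : Submodule ℝ E, IsClosed (Z : Set E) ∧
    Nonempty (lp (fun _ : ℕ => ℝ) 1 ≃L[ℝ] Z)

/-- Property `KM_w`. -/
def HasKMw (X : Type*) [NormedAddCommGroup X] [NormedSpace ℝ X] : Prop :=
  ∃ M : ℕ → ℕ → Set X,
    (∀ n p : ℕ, 0 < p → IsWeaklyPrecompactWith (1 / (p : ℝ)) (M n p)) ∧
    (∀ C : Set X, IsWeaklyPrecompactWith 0 C → ∀ p : ℕ, 0 < p → ∃ n : ℕ, C ⊆ M n p)

namespace KMw

/-- Generic diagonal recursion along decreasing infinite sets. -/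
lemma diag_rec {σ : Type*} (P : σ → Set ℕ → Prop) (R : σ → ℕ → σ → Set ℕ → Prop)
    (s0 : σ) (M0 : Set ℕ) (h0 : P s0 M0)
    (step : ∀ s M, P s M → ∃ j ∈ M, ∃ M' ⊆ M ∩ Set.Ioi j, ∃ s', P s' M' ∧ R s j s' M') :
    ∃ (s : ℕ → σ) (j : ℕ → ℕ) (M : ℕ → Set ℕ), s 0 = s0 ∧ M 0 = M0 ∧
      (∀ k, P (s k) (M k)) ∧ StrictMono j ∧ (∀ k i, k ≤ i → j i ∈ M k) ∧
      ∀ k, R (s k) (j k) (s (k + 1)) (M (k + 1)) := by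
  choose! J hJ M' hM' S' hP hR using step
  let st : ℕ → σ × Set ℕ := fun k =>
    Nat.rec (s0, M0) (fun _ p => (S' p.1 p.2, M' p.1 p.2)) k
  have hst : ∀ k, P (st k).1 (st k).2 := by
    intro k
    induction k with
    | zero => exact h0
    | succ k ih => exact hP _ _ ih
  have hsub : ∀ k, (st (k+1)).2 ⊆ (st k).2 ∩ Set.Ioi (J (st k).1 (st k).2) :=
    fun k => hM' _ _ (hst k)
  have hanti : Antitone fun k => (st k).2 :=
    antitone_nat_of_succ_le fun k => (hsub k).trans Set.inter_subset_left
  refine ⟨fun k => (st k).1, fun k => J (st k).1 (st k).2, fun k => (st k).2, rfl, rfl, hst,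
    ?_, ?_, fun k => hR _ _ (hst k)⟩
  · refine strictMono_nat_of_lt_succ fun k => ?_
    exact (hsub k (hJ _ _ (hst (k+1)))).2
  · intro k i hki
    exact hanti hki (hJ _ _ (hst i))

/-- No point of `D` is frequently in both families along `M`. -/
def Conv {S : Type*} (A : Bool → ℕ → Set S) (D : Set S) (M : Set ℕ) : Prop :=
  ∀ s ∈ D, ¬ ∀ b, {n ∈ M | s ∈ A b n}.Infinite

def NC {S : Type*} (A : Bool → ℕ → Set S) (D : Set S) (M : Set ℕ) : Prop :=
  ∀ M' ⊆ M, M'.Infinite → ¬ Conv A D M'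

lemma NC.mono {S : Type*} {A : Bool → ℕ → Set S} {D : Set S} {M M' : Set ℕ}
    (h : NC A D M) (hM : M' ⊆ M) : NC A D M' := fun N hN => h N (hN.trans hM)

lemma infinite_inter_Ioi {M : Set ℕ} (h : M.Infinite) (j : ℕ) : (M ∩ Set.Ioi j).Infinite := by
  intro hf
  apply h
  refine (hf.union (Set.finite_Iic j)).subset fun n hn => ?_
  by_cases hj : n ≤ j
  · exact Or.inr hj
  · exact Or.inl ⟨hn, not_le.1 hj⟩

lemma step_lemma {S : Type*} (A : Bool → ℕ → Set S) (F : Set (Set S)) (hF : F.Finite)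
    (M : Set ℕ) (hM : M.Infinite) (h : ∀ D ∈ F, NC A D M) :
    ∃ j ∈ M, ∃ M' ⊆ M ∩ Set.Ioi j, M'.Infinite ∧ ∀ D ∈ F, ∀ b, NC A (D ∩ A b j) M' := by
  by_contra hcon
  push Not at hcon
  obtain ⟨s, j, N, -, hN0, hP, hj, hjN, hR⟩ := diag_rec
    (σ := Option (F × Bool)) (fun _ N => N.Infinite ∧ N ⊆ M)
    (fun _ j s' N' => ∃ t : F × Bool, s' = some t ∧ Conv A (t.1.1 ∩ A t.2 j) N')
    none M ⟨hM, subset_rfl⟩ (by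
      rintro - N ⟨hN, hNM⟩
      obtain ⟨j, hj⟩ := hN.nonempty
      obtain ⟨D, hD, b, hb⟩ := hcon j (hNM hj) (N ∩ Set.Ioi j)
        (Set.inter_subset_inter_left _ hNM) (infinite_inter_Ioi hN j)
      unfold NC at hb
      push Not at hb
      obtain ⟨N', hN', hi, hc⟩ := hb
      exact ⟨j, hj, N', hN', some (⟨D, hD⟩, b),
        ⟨hi, (hN'.trans Set.inter_subset_left).trans hNM⟩, _, rfl, hc⟩)
  choose t ht hc using hR
  have : Finite F := hF
  obtain ⟨⟨⟨D, hD⟩, b⟩, hinf⟩ := Finite.exists_infinite_fiber t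
  have hinf' : (t ⁻¹' {(⟨D, hD⟩, b)}).Infinite := Set.infinite_coe_iff.1 hinf
  have hJ : (j '' (t ⁻¹' {(⟨D, hD⟩, b)})).Infinite := hinf'.image hj.injective.injOn
  refine h D hD _ ?_ hJ ?_
  · rintro _ ⟨k, -, rfl⟩
    have := hjN 0 k (Nat.zero_le _)
    rwa [hN0] at this
  · intro x hx hall
    obtain ⟨_, ⟨k, hk, rfl⟩, hxk⟩ := (hall b).nonempty
    have hk' : t k = (⟨D, hD⟩, b) := hk
    have hck := hc k
    rw [hk'] at hck
    refine hck x ⟨hx, hxk⟩ fun b' => ?_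
    have := infinite_inter_Ioi (hall b') (j k)
    refine this.mono ?_
    rintro _ ⟨⟨⟨i, hi, rfl⟩, hxi⟩, hlt⟩
    refine ⟨hjN _ _ ?_, hxi⟩
    exact hj.lt_iff_lt.1 hlt

lemma exists_indep {S : Type*} (A : Bool → ℕ → Set S) (M : Set ℕ) (hM : M.Infinite)
    (h : NC A Set.univ M) :
    ∃ j : ℕ → ℕ, StrictMono j ∧ ∀ (P : ℕ → Bool) (k : ℕ), ∃ x, ∀ i < k, x ∈ A (P i) (j i) := by
  obtain ⟨s, j, N, hs0, hN0, hP, hj, hjN, hR⟩ := diag_rec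
    (σ := Set (Set S)) (fun F N => F.Finite ∧ N.Infinite ∧ ∀ D ∈ F, NC A D N)
    (fun F j F' _ => ∀ D ∈ F, ∀ b, D ∩ A b j ∈ F') {Set.univ} M
    ⟨Set.finite_singleton _, hM, by simpa using h⟩ (by
      rintro F N ⟨hF, hN, hNC⟩
      obtain ⟨j, hjN, N', hN', hi, hnc⟩ := step_lemma A F hF N hN hNC
      refine ⟨j, hjN, N', hN', (fun p : Set S × Bool => p.1 ∩ A p.2 j) '' (F ×ˢ Set.univ),
        ⟨(hF.prod Set.finite_univ).image _, hi, ?_⟩, ?_⟩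
      · rintro _ ⟨⟨D, b⟩, hD, rfl⟩
        exact hnc D hD.1 b
      · intro D hD b
        exact ⟨(D, b), ⟨hD, trivial⟩, rfl⟩)
  refine ⟨j, hj, fun P k => ?_⟩
  have key : ∀ k, ∃ D ∈ s k, ∀ x ∈ D, ∀ i < k, x ∈ A (P i) (j i) := by
    intro k
    induction k with
    | zero => exact ⟨Set.univ, by simp [hs0], by simp⟩
    | succ k ih =>
      obtain ⟨D, hD, hx⟩ := ih
      refine ⟨_, hR k D hD (P k), fun x hxD i hi => ?_⟩
      rcases Nat.lt_succ_iff_lt_or_eq.1 hi with h | rfl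
      · exact hx x hxD.1 i h
      · exact hxD.2
  obtain ⟨D, hD, hx⟩ := key k
  have := (hP k).2.2 D hD (N k) subset_rfl (hP k).2.1
  unfold Conv at this
  push Not at this
  obtain ⟨x, hxD, -⟩ := this
  exact ⟨x, hx x hxD⟩

/-- Diagonalisation over countably many pairs of families. -/
lemma exists_diag {S : Type*} (A : ℕ → Bool → ℕ → Set S)
    (h : ∀ k, ∀ M : Set ℕ, M.Infinite → ∃ M' ⊆ M, M'.Infinite ∧ Conv (A k) Set.univ M') :
    ∃ φ : ℕ → ℕ, StrictMono φ ∧ ∀ k x, ¬ ∀ b, ∃ᶠ n in atTop, x ∈ A k b (φ n) := by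
  obtain ⟨s, j, N, hs0, hN0, hP, hj, hjN, hR⟩ := diag_rec
    (σ := ℕ) (fun _ N => N.Infinite)
    (fun k _ k' N' => k' = k + 1 ∧ Conv (A k) Set.univ N') 0 Set.univ
    Set.infinite_univ (by
      rintro k N hN
      obtain ⟨j, hj⟩ := hN.nonempty
      obtain ⟨N', hN', hi, hc⟩ := h k _ (infinite_inter_Ioi hN j)
      exact ⟨j, hj, N', hN', k + 1, hi, rfl, hc⟩)
  have hs : ∀ k, s k = k := by
    intro k
    induction k with
    | zero => exact hs0
    | succ k ih => rw [(hR k).1, ih]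
  refine ⟨j, hj, fun k x hall => ?_⟩
  have hc := (hR k).2
  rw [hs] at hc
  refine hc x trivial fun b => ?_
  have h1 : {n | x ∈ A k b (j n)}.Infinite := Nat.frequently_atTop_iff_infinite.1 (hall b)
  have h2 := (infinite_inter_Ioi h1 k).image hj.injective.injOn
  refine h2.mono ?_
  rintro _ ⟨n, ⟨hn, hkn⟩, rfl⟩
  exact ⟨hjN _ _ hkn, hn⟩

end KMw

namespace KMw

section Bounded
variable {E : Type*} [NormedAddCommGroup E] [NormedSpace ℝ E]

lemma bdd_le {x : ℕ → E} {C : ℝ} (hx : ∀ n, ‖x n‖ ≤ C) (f : E →L[ℝ] ℝ) :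
    IsBoundedUnder (· ≤ ·) atTop (fun n => f (x n)) :=
  isBoundedUnder_of ⟨‖f‖ * C, fun n => (le_abs_self _).trans
    ((f.le_opNorm _).trans (mul_le_mul_of_nonneg_left (hx n) (norm_nonneg _)))⟩

lemma bdd_ge {x : ℕ → E} {C : ℝ} (hx : ∀ n, ‖x n‖ ≤ C) (f : E →L[ℝ] ℝ) :
    IsBoundedUnder (· ≥ ·) atTop (fun n => f (x n)) :=
  isBoundedUnder_of ⟨-(‖f‖ * C), fun n => neg_le_of_abs_le
    ((f.le_opNorm _).trans (mul_le_mul_of_nonneg_left (hx n) (norm_nonneg _)))⟩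

lemma DeltaLE.eventually {x : ℕ → E} {C ε e : ℝ} (hx : ∀ n, ‖x n‖ ≤ C) (h : DeltaLE x ε)
    (f : E →L[ℝ] ℝ) (hf : ‖f‖ ≤ 1) (he : ε < e) :
    ∃ N, ∀ m ≥ N, ∀ n ≥ N, f (x m) - f (x n) < e := by
  have h1 := h f hf
  have h2 := eventually_lt_of_limsup_lt (b := limsup (fun n => f (x n)) atTop + (e - ε) / 2)
    (by linarith) (bdd_le hx f)
  have h3 := eventually_lt_of_lt_liminf (b := liminf (fun n => f (x n)) atTop - (e - ε) / 2)
    (by linarith) (bdd_ge hx f)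
  obtain ⟨N, hN⟩ := eventually_atTop.1 (h2.and h3)
  refine ⟨N, fun m hm n hn => ?_⟩
  have := (hN m hm).1
  have := (hN n hn).2
  linarith

lemma deltaLE_of_pairs {x : ℕ → E} {C ε : ℝ} (hx : ∀ n, ‖x n‖ ≤ C)
    (h : ∀ f : E →L[ℝ] ℝ, ‖f‖ ≤ 1 → ∀ r s : ℚ, ε < (s : ℝ) - r →
      ¬ ((∃ᶠ n in atTop, (s : ℝ) < f (x n)) ∧ (∃ᶠ n in atTop, f (x n) < r))) :
    DeltaLE x ε := by
  intro f hf
  by_contra hcon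
  push Not at hcon
  set L := limsup (fun n => f (x n)) atTop
  set l := liminf (fun n => f (x n)) atTop
  obtain ⟨s, hs1, hs2⟩ := exists_rat_btwn (show L - (L - l - ε) / 2 < L by linarith)
  obtain ⟨r, hr1, hr2⟩ := exists_rat_btwn (show l < l + (L - l - ε) / 2 by linarith)
  refine h f hf r s (by linarith) ⟨?_, ?_⟩
  · exact frequently_lt_of_lt_limsup (bdd_ge hx f).isCoboundedUnder_le hs2
  · exact frequently_lt_of_liminf_lt (bdd_le hx f).isCoboundedUnder_ge hr1

/-- Rosenthal-type dichotomy. -/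
lemma rosenthal {x : ℕ → E} {C ε : ℝ} (hx : ∀ n, ‖x n‖ ≤ C)
    (h : ¬ ∃ φ : ℕ → ℕ, StrictMono φ ∧ DeltaLE (fun k => x (φ k)) ε) :
    ∃ r s : ℝ, ε < s - r ∧ ∃ φ : ℕ → ℕ, StrictMono φ ∧ ∀ (P : ℕ → Bool) (k : ℕ),
      ∃ f : E →L[ℝ] ℝ, ‖f‖ ≤ 1 ∧ ∀ i < k,
        (P i = true → s < f (x (φ i))) ∧ (P i = false → f (x (φ i)) < r) := by
  classical
  let S := {f : E →L[ℝ] ℝ // ‖f‖ ≤ 1}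
  let A : ℚ × ℚ → Bool → ℕ → Set S := fun p b n =>
    {f | if b then (p.2 : ℝ) < f.1 (x n) else f.1 (x n) < p.1}
  have key : ∃ p : ℚ × ℚ, ε < (p.2 : ℝ) - p.1 ∧ ∃ M : Set ℕ, M.Infinite ∧ NC (A p) Set.univ M := by
    by_contra hcon
    push Not at hcon
    obtain ⟨enum, henum⟩ := exists_surjective_nat (ℚ × ℚ)
    let A' : ℕ → Bool → ℕ → Set S := fun k =>
      if ε < ((enum k).2 : ℝ) - (enum k).1 then A (enum k) else fun _ _ => ∅
    obtain ⟨φ, hφ, hc⟩ := exists_diag A' (by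
      intro k M hM
      by_cases hk : ε < ((enum k).2 : ℝ) - (enum k).1
      · have := hcon _ hk M hM
        unfold NC at this
        push Not at this
        simpa [A', hk] using this
      · refine ⟨M, subset_rfl, hM, fun s _ hall => ?_⟩
        simpa [A', hk] using hall true)
    refine h ⟨φ, hφ, deltaLE_of_pairs (fun n => hx (φ n)) ?_⟩
    rintro f hf r s hrs ⟨h1, h2⟩
    obtain ⟨k, hk⟩ := henum (r, s)
    refine hc k ⟨f, hf⟩ fun b => ?_
    cases b
    · simpa [A', hk, hrs, A] using h2
    · simpa [A', hk, hrs, A] using h1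
  obtain ⟨⟨r, s⟩, hrs, M, hM, hNC⟩ := key
  obtain ⟨φ, hφ, hind⟩ := exists_indep _ M hM hNC
  refine ⟨r, s, hrs, φ, hφ, fun P k => ?_⟩
  obtain ⟨f, hf⟩ := hind P k
  refine ⟨f.1, f.2, fun i hi => ?_⟩
  have := hf i hi
  constructor <;> intro hP <;> simpa [A, hP] using this

/-- Sign-independent sequences generate `ℓ₁`. -/
lemma containsL1_of_signs [CompleteSpace E] (y : ℕ → E) (C η : ℝ) (hη : 0 < η)
    (hy : ∀ n, ‖y n‖ ≤ C)
    (h : ∀ (P : ℕ → Bool) (k : ℕ), ∃ f : E →L[ℝ] ℝ, ‖f‖ ≤ 1 ∧ ∀ i < k,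
        (P i = true → η ≤ f (y i)) ∧ (P i = false → f (y i) ≤ -η)) :
    ContainsL1 E := by
  have hC : 0 ≤ C := (norm_nonneg _).trans (hy 0)
  have hsn : ∀ a : lp (fun _ : ℕ => ℝ) 1, HasSum (fun i => ‖a i‖) ‖a‖ := by
    intro a
    simpa using lp.hasSum_norm (p := 1) (by simp) a
  have hle : ∀ (a : lp (fun _ : ℕ => ℝ) 1) i, ‖a i • y i‖ ≤ ‖a i‖ * C := fun a i => by
    rw [norm_smul]; exact mul_le_mul_of_nonneg_left (hy i) (norm_nonneg _)
  have hsum : ∀ a : lp (fun _ : ℕ => ℝ) 1, Summable (fun i => a i • y i) := fun a =>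
    Summable.of_norm_bounded ((hsn a).summable.mul_right C) (hle a)
  let T0 : lp (fun _ : ℕ => ℝ) 1 →ₗ[ℝ] E :=
    { toFun := fun a => ∑' i, a i • y i
      map_add' := fun a b => by
        rw [← (hsum a).tsum_add (hsum b)]
        exact tsum_congr fun i => by simp [add_smul]
      map_smul' := fun c a => by
        rw [RingHom.id_apply, ← (hsum a).tsum_const_smul]
        exact tsum_congr fun i => by simp [mul_smul] }
  let T : lp (fun _ : ℕ => ℝ) 1 →L[ℝ] E := T0.mkContinuous C fun a => by
    have := tsum_of_norm_bounded ((hsn a).mul_right C) (hle a)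
    rw [mul_comm]; exact this
  have hfin : ∀ (a : ℕ → ℝ) (k : ℕ),
      η * ∑ i ∈ Finset.range k, ‖a i‖ ≤ ‖∑ i ∈ Finset.range k, a i • y i‖ := by
    intro a k
    obtain ⟨f, hf, hfi⟩ := h (fun i => decide (0 ≤ a i)) k
    calc η * ∑ i ∈ Finset.range k, ‖a i‖ = ∑ i ∈ Finset.range k, η * ‖a i‖ := Finset.mul_sum ..
      _ ≤ ∑ i ∈ Finset.range k, a i * f (y i) := by
        refine Finset.sum_le_sum fun i hi => ?_
        obtain ⟨h1, h2⟩ := hfi i (Finset.mem_range.1 hi)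
        rcases le_or_gt 0 (a i) with h0 | h0
        · have := h1 (by simpa using h0)
          rw [Real.norm_of_nonneg h0]; nlinarith
        · have := h2 (by simpa using h0)
          rw [Real.norm_of_nonpos h0.le]; nlinarith
      _ = f (∑ i ∈ Finset.range k, a i • y i) := by simp
      _ ≤ ‖f‖ * ‖∑ i ∈ Finset.range k, a i • y i‖ := (le_abs_self _).trans (f.le_opNorm _)
      _ ≤ _ := mul_le_of_le_one_left (norm_nonneg _) hf
  have hlow : ∀ a, η * ‖a‖ ≤ ‖T a‖ := fun a =>
    le_of_tendsto_of_tendsto' ((hsn a).tendsto_sum_nat.const_mul η)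
      ((hsum a).hasSum.tendsto_sum_nat.norm) (hfin a)
  have hanti : AntilipschitzWith (Real.toNNReal η⁻¹) T := by
    refine T.antilipschitz_of_bound fun a => ?_
    rw [Real.coe_toNNReal _ (inv_nonneg.2 hη.le), inv_mul_eq_div, le_div_iff₀' hη]
    exact hlow a
  have hcl := hanti.isClosed_range T.uniformContinuous
  exact ⟨T.range, hcl, ⟨T.equivRange hanti.injective hcl⟩⟩

/-- Convex combinations far out with small image. -/
lemma exists_small_block {F : Type*} [NormedAddCommGroup F] [NormedSpace ℝ F]
    (q : E →L[ℝ] F) (x : ℕ → E) {d : ℝ} (hdpos : 0 < d)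
    (h : ∀ f : F →L[ℝ] ℝ, ‖f‖ ≤ 1 → ∃ N, ∀ m ≥ N, ∀ n ≥ N, f (q (x m)) - f (q (x n)) < d)
    (N : ℕ) :
    ∃ N' > N, ∃ u ∈ convexHull ℝ ((fun i => x (2 * i) - x (2 * i + 1)) '' Set.Ico N N'),
      ‖q u‖ < d := by
  classical
  set w : ℕ → E := fun i => x (2 * i) - x (2 * i + 1)
  have h1 : ∃ u ∈ convexHull ℝ (w '' Set.Ici N), ‖q u‖ < d := by
    by_contra hcon
    push Not at hcon
    have hdisj : Disjoint (Metric.ball (0 : F) d) (q '' convexHull ℝ (w '' Set.Ici N)) := by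
      rw [Set.disjoint_left]
      rintro _ hv ⟨u, hu, rfl⟩
      exact absurd (mem_ball_zero_iff.1 hv) (not_lt.2 (hcon u hu))
    obtain ⟨f, c, hfc, hc⟩ := geometric_hahn_banach_open (convex_ball (0 : F) d) Metric.isOpen_ball
      ((convex_convexHull ℝ _).linear_image q.toLinearMap) hdisj
    have hc0 : 0 < c := by simpa using hfc 0 (Metric.mem_ball_self hdpos)
    have hfw : ∀ i ≥ N, c ≤ f (q (w i)) := fun i hi =>
      hc _ ⟨w i, subset_convexHull ℝ _ ⟨i, hi, rfl⟩, rfl⟩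
    have hnorm : ‖f‖ ≤ c / d := by
      refine f.opNorm_le_of_unit_norm (by positivity) fun v hv => ?_
      have hball : ∀ t, |t| < d → f (t • v) < c := fun t ht => hfc _ (by
        simp [norm_smul, hv, ht])
      rw [le_div_iff₀ hdpos]
      refine le_of_forall_lt fun z hz => ?_
      by_contra hzc
      push Not at hzc
      have hfv : 0 < |f v| := by
        by_contra h0
        have : |f v| = 0 := le_antisymm (not_lt.1 h0) (abs_nonneg _)
        rw [Real.norm_eq_abs, this] at hz
        linarith
      have hz' : z / |f v| < d := by rw [div_lt_iff₀' hfv]; exact hz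
      have hzp : 0 ≤ z / |f v| := div_nonneg (hc0.le.trans hzc) hfv.le
      rcases abs_cases (f v) with ⟨h1, h2⟩ | ⟨h1, h2⟩
      · have := hball (z / |f v|) (by rwa [abs_of_nonneg hzp])
        rw [map_smul, smul_eq_mul] at this
        nth_rw 2 [← h1] at this
        rw [div_mul_cancel₀ _ hfv.ne'] at this
        linarith
      · have := hball (-(z / |f v|)) (by rwa [abs_neg, abs_of_nonneg hzp])
        rw [map_smul, smul_eq_mul, neg_mul, ← mul_neg, ← h1, div_mul_cancel₀ _ hfv.ne'] at this
        linarith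
    have hg : ‖(d / c) • f‖ ≤ 1 := by
      rw [norm_smul, Real.norm_of_nonneg (by positivity)]
      calc d / c * ‖f‖ ≤ d / c * (c / d) := by gcongr
        _ = 1 := by field_simp
    obtain ⟨K, hK⟩ := h _ hg
    have h2 := hK (2 * (max N K)) (by have := le_max_right N K; omega)
      (2 * (max N K) + 1) (by have := le_max_right N K; omega)
    have h3 := hfw (max N K) (le_max_left _ _)
    have h4 : f (q (w (max N K))) = f (q (x (2 * max N K))) - f (q (x (2 * max N K + 1))) := by
      simp [w]
    rw [h4] at h3
    simp only [smul_apply, smul_eq_mul, ← mul_sub] at h2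
    have h5 : d / c * c ≤ d / c * (f (q (x (2 * max N K))) - f (q (x (2 * max N K + 1)))) :=
      mul_le_mul_of_nonneg_left h3 (by positivity)
    rw [div_mul_cancel₀ _ hc0.ne'] at h5
    linarith
  obtain ⟨u, hu, hud⟩ := h1
  rw [convexHull_eq_union_convexHull_finite_subsets] at hu
  simp only [Set.mem_iUnion] at hu
  obtain ⟨t, ht, hut⟩ := hu
  obtain ⟨t', ht', hwt⟩ := Finset.subset_set_image_iff.1 ht
  refine ⟨max (N + 1) (t'.sup id + 1), lt_max_of_lt_left (Nat.lt_succ_self _), u, ?_, hud⟩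
  refine convexHull_mono ?_ hut
  rw [← hwt]
  intro v hv
  simp only [Finset.coe_image] at hv
  obtain ⟨i, hi, rfl⟩ := hv
  refine ⟨i, ⟨ht' hi, lt_max_of_lt_right (Nat.lt_succ_of_le ?_)⟩, rfl⟩
  exact Finset.le_sup (f := id) hi

end Bounded

/-- Quantitative Lohman lifting. -/
lemma lohman {X : Type*} [NormedAddCommGroup X] [NormedSpace ℝ X] [CompleteSpace X]
    (Y : Submodule ℝ X) [hY : IsClosed (Y : Set X)] (hl1 : ¬ ContainsL1 Y)
    (x : ℕ → X) {C ε : ℝ} (hε : 0 ≤ ε) (hx : ∀ n, ‖x n‖ ≤ C)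
    (h : DeltaLE (fun n => (Y.mkQL (x n))) ε) :
    ∃ φ : ℕ → ℕ, StrictMono φ ∧ DeltaLE (fun k => x (φ k)) ε := by
  classical
  by_contra hno
  obtain ⟨r, s, hrs, φ, hφ, hind⟩ := rosenthal hx hno
  obtain ⟨d, hd1, hd2⟩ := exists_between hrs
  have hdpos : 0 < d := hε.trans_lt hd1
  have hqx : ∀ n, ‖Y.mkQL (x n)‖ ≤ ‖Y.mkQL‖ * C := fun n =>
    (Y.mkQL.le_opNorm _).trans (mul_le_mul_of_nonneg_left (hx n) (norm_nonneg _))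
  have hblock := exists_small_block Y.mkQL (fun k => x (φ k)) hdpos (by
    intro f hf
    obtain ⟨N, hN⟩ := DeltaLE.eventually hqx h f hf hd1
    exact ⟨N, fun m hm n hn => hN _ (hm.trans (hφ.id_le m)) _ (hn.trans (hφ.id_le n))⟩)
  set w : ℕ → X := fun i => x (φ (2 * i)) - x (φ (2 * i + 1))
  choose N' hN' U hU hUd using hblock
  let a : ℕ → ℕ := fun k => Nat.rec (motive := fun _ => ℕ) 0 (fun _ n => N' n) k
  have ha : StrictMono a := strictMono_nat_of_lt_succ fun k => hN' (a k)
  have hUw : ∀ k, U (a k) ∈ convexHull ℝ (w '' Set.Ico (a k) (a (k + 1))) := fun k => hU (a k)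
  have hwC : ∀ i, ‖w i‖ ≤ C + C := fun i => (norm_sub_le _ _).trans (add_le_add (hx _) (hx _))
  have hUC : ∀ k, ‖U (a k)‖ ≤ C + C := by
    intro k
    have : convexHull ℝ (w '' Set.Ico (a k) (a (k + 1))) ⊆ Metric.closedBall 0 (C + C) := by
      refine convexHull_min ?_ (convex_closedBall _ _)
      rintro _ ⟨i, -, rfl⟩
      simpa using hwC i
    simpa using this (hUw k)
  have hy : ∀ k, ∃ y : Y, ‖U (a k) - y‖ < d := by
    intro k
    obtain ⟨m, hm, hlt⟩ := QuotientAddGroup.exists_norm_mk_lt (S := Y.toAddSubgroup)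
      (Y.mkQL (U (a k))) (sub_pos.2 (hUd (a k)))
    have hmem : U (a k) - m ∈ Y := (Submodule.Quotient.eq Y).1 hm.symm
    refine ⟨⟨U (a k) - m, hmem⟩, ?_⟩
    have : U (a k) - (U (a k) - m) = m := by abel
    rw [this]
    refine hlt.trans_eq ?_
    exact add_sub_cancel _ _
  choose y hyd using hy
  have hcomp : CompleteSpace Y := hY.completeSpace_coe
  refine hl1 (containsL1_of_signs y (C + C + d) (s - r - d) (by linarith) ?_ ?_)
  · intro k
    have h1 : (y k : X) = U (a k) - (U (a k) - y k) := by abel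
    have h2 : ‖(y k : X)‖ ≤ ‖U (a k)‖ + ‖U (a k) - y k‖ := by
      conv_lhs => rw [h1]
      exact norm_sub_le _ _
    have h3 := hUC k
    have h4 := hyd k
    rw [← Submodule.norm_coe]
    linarith
  · intro P k
    let Q : ℕ → Bool := fun i : ℕ => decide (∃ j : ℕ, P j = true ∧ a j ≤ i ∧ i < a (j + 1))
    have hQ : ∀ j, ∀ i ∈ Set.Ico (a j) (a (j + 1)), Q i = P j := by
      intro j i hi
      cases hP : P j with
      | true => simpa [Q] using ⟨j, hP, hi⟩
      | false =>
        simp only [Q, decide_eq_false_iff_not]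
        rintro ⟨j', hP', hi'⟩
        have hne : j' ≠ j := by rintro rfl; simp [hP] at hP'
        exact Set.disjoint_left.1 (ha.monotone.pairwise_disjoint_on_Ico_succ hne) hi' hi
    obtain ⟨f, hf, hfi⟩ := hind (fun n => if n % 2 = 0 then Q (n / 2) else !Q (n / 2)) (2 * a k)
    have hfw : ∀ i < a k, (Q i = true → s - r ≤ f (w i)) ∧ (Q i = false → f (w i) ≤ -(s - r)) := by
      intro i hi
      have e1 := hfi (2 * i) (by omega)
      have e2 := hfi (2 * i + 1) (by omega)
      have m1 : 2 * i % 2 = 0 := by omega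
      have m2 : ¬ (2 * i + 1) % 2 = 0 := by omega
      have m3 : 2 * i / 2 = i := by omega
      have m4 : (2 * i + 1) / 2 = i := by omega
      rw [if_pos m1, m3] at e1
      rw [if_neg m2, m4] at e2
      have hw : f (w i) = f (x (φ (2 * i))) - f (x (φ (2 * i + 1))) := by simp [w]
      rw [hw]
      constructor
      · intro hq
        have := e1.1 hq
        have := e2.2 (by simp [hq])
        linarith
      · intro hq
        have := e1.2 hq
        have := e2.1 (by simp [hq])
        linarith
    have hfd : ∀ i, |f (U (a i)) - f (y i)| ≤ d := by
      intro i
      rw [← map_sub]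
      exact (f.le_opNorm _).trans
        ((mul_le_of_le_one_left (norm_nonneg _) hf).trans (hyd i).le)
    refine ⟨f.comp Y.subtypeL, ?_, fun i hi => ?_⟩
    · refine ContinuousLinearMap.opNorm_le_bound _ zero_le_one fun v => ?_
      exact (f.le_opNorm _).trans (mul_le_mul_of_nonneg_right hf (norm_nonneg _))
    · have hai : a (i + 1) ≤ a k := ha.monotone hi
      have hd' := abs_le.1 (hfd i)
      constructor
      · intro hP
        have : convexHull ℝ (w '' Set.Ico (a i) (a (i + 1))) ⊆ {v | s - r ≤ f v} := by
          refine convexHull_min ?_ (convex_halfSpace_ge f.isLinear _)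
          rintro _ ⟨n, hn, rfl⟩
          exact (hfw n (hn.2.trans_le hai)).1 ((hQ i n hn).trans hP)
        have h1 : s - r ≤ f (U (a i)) := this (hUw i)
        change s - r - d ≤ f (y i)
        linarith [hd'.2]
      · intro hP
        have : convexHull ℝ (w '' Set.Ico (a i) (a (i + 1))) ⊆ {v | f v ≤ -(s - r)} := by
          refine convexHull_min ?_ (convex_halfSpace_le f.isLinear _)
          rintro _ ⟨n, hn, rfl⟩
          exact (hfw n (hn.2.trans_le hai)).2 ((hQ i n hn).trans hP)
        have h1 : f (U (a i)) ≤ -(s - r) := this (hUw i)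
        change f (y i) ≤ -(s - r - d)
        linarith [hd'.1]

lemma norm_mkQL_apply_le {X : Type*} [NormedAddCommGroup X] [NormedSpace ℝ X]
    (Y : Submodule ℝ X) (v : X) : ‖Y.mkQL v‖ ≤ ‖v‖ :=
  QuotientAddGroup.norm_mk_le_norm (S := Y.toAddSubgroup)

lemma wpc_image {X : Type*} [NormedAddCommGroup X] [NormedSpace ℝ X]
    (Y : Submodule ℝ X) [hY : IsClosed (Y : Set X)] {ε : ℝ} {M : Set X}
    (hM : IsWeaklyPrecompactWith ε M) : IsWeaklyPrecompactWith ε (Y.mkQL '' M) := by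
  refine ⟨?_, fun z hz => ?_⟩
  · obtain ⟨C, hC⟩ := hM.1.exists_norm_le
    refine isBounded_iff_forall_norm_le.2 ⟨C, ?_⟩
    rintro _ ⟨v, hv, rfl⟩
    exact (norm_mkQL_apply_le Y v).trans (hC v hv)
  · choose x hx hxz using hz
    obtain ⟨φ, hφ, hd⟩ := hM.2 x hx
    refine ⟨φ, hφ, fun f hf => ?_⟩
    have := hd (f.comp Y.mkQL) (by
      refine ContinuousLinearMap.opNorm_le_bound _ zero_le_one fun v => ?_
      exact (f.le_opNorm _).trans
        (mul_le_mul hf (norm_mkQL_apply_le Y v) (norm_nonneg _) zero_le_one))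
    simpa [← hxz] using this

lemma wpc_preimage {X : Type*} [NormedAddCommGroup X] [NormedSpace ℝ X] [CompleteSpace X]
    (Y : Submodule ℝ X) [hY : IsClosed (Y : Set X)] (hl1 : ¬ ContainsL1 Y) {ε : ℝ} (hε : 0 ≤ ε)
    (C : ℝ) {M : Set (X ⧸ Y)}
    (hM : IsWeaklyPrecompactWith ε M) :
    IsWeaklyPrecompactWith ε (Y.mkQL ⁻¹' M ∩ Metric.closedBall 0 C) := by
  refine ⟨Metric.isBounded_closedBall.subset Set.inter_subset_right, fun x hx => ?_⟩
  obtain ⟨φ, hφ, hd⟩ := hM.2 (fun n => Y.mkQL (x n)) fun n => (hx n).1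
  obtain ⟨ψ, hψ, hd'⟩ := lohman Y hl1 (fun n => x (φ n)) (C := C) hε
    (fun n => by simpa using (hx (φ n)).2) hd
  exact ⟨fun n => φ (ψ n), hφ.comp hψ, hd'⟩

end KMw

theorem hasKMw_iff_quotient_hasKMw
    {X : Type*} [NormedAddCommGroup X] [NormedSpace ℝ X] [CompleteSpace X]
    (Y : Submodule ℝ X) [hY : IsClosed (Y : Set X)]
    (hl1 : ¬ ContainsL1 Y) :
    HasKMw X ↔ HasKMw (X ⧸ Y) := by
  constructor
  · rintro ⟨M, hM, hC⟩
    refine ⟨fun n p => Y.mkQL '' M n p, fun n p hp => KMw.wpc_image Y (hM n p hp), ?_⟩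
    intro K hK p hp
    obtain ⟨R, hR⟩ := hK.1.exists_norm_le
    obtain ⟨n, hn⟩ := hC _ (KMw.wpc_preimage Y hl1 le_rfl (R + 1) hK) p hp
    refine ⟨n, fun z hz => ?_⟩
    obtain ⟨m, hm, hlt⟩ := QuotientAddGroup.exists_norm_mk_lt (S := Y.toAddSubgroup) z one_pos
    have hm' : Y.mkQL m = z := hm
    refine ⟨m, hn ⟨?_, ?_⟩, hm'⟩
    · rw [Set.mem_preimage, hm']; exact hz
    · rw [mem_closedBall_zero_iff]
      exact hlt.le.trans (by have := hR z hz; gcongr; exact this)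
  · rintro ⟨M, hM, hC⟩
    refine ⟨fun n p => Y.mkQL ⁻¹' M n.unpair.1 p ∩ Metric.closedBall 0 (n.unpair.2 : ℝ),
      fun n p hp => KMw.wpc_preimage Y hl1 (by positivity) _ (hM _ p hp), ?_⟩
    intro K hK p hp
    obtain ⟨R, hR⟩ := hK.1.exists_norm_le
    obtain ⟨m, hm⟩ := exists_nat_ge R
    obtain ⟨n, hn⟩ := hC _ (KMw.wpc_image Y hK) p hp
    refine ⟨Nat.pair n m, fun v hv => ?_⟩
    simp only [Nat.unpair_pair]
    exact ⟨hn ⟨v, hv, rfl⟩, by simpa using (hR v hv).trans hm⟩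
end
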